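/- arXiv:2001.02481 — 2 statements merged into one kernel-verified Lean document; each statement's English description precedes it below -/
import Mathlib

section
/- Let δ > 0 be an arbitrary constant and let g : ℕ → ℕ be any monotone nondecreasing function with g(n) → ∞ and g(n) ≤ n^{1/4}. Then there is a family {G_n} of DAGs, each with a unique sink and maximum in-degree 2, where G_n has Θ(n) vertices, such that: (1) the reversible pebbling price of G_n is at most g(n)·log n; (2) for every constant ε > 0 there is a reversible pebbling of G_n with time O(n^{1+ε}) and space O(n^{1/2}·log n / g(n)); and (3) there is a constant K > 0 such that every standard pebbling of G_n with space at most K·n^{1/2−δ}/g(n) has time superpolynomial in n (i.e., for every constant k, the time exceeds n^k for all sufficiently large n). -/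
open MvPolynomial

/-- A finite directed graph. -/
structure FinDigraph where
  V : Type
  [instFintype : Fintype V]
  Edge : V → V → Prop

attribute [instance] FinDigraph.instFintype

namespace FinDigraph

/-- The set of (immediate) predecessors of a vertex. -/
def pred (G : FinDigraph) (v : G.V) : Set G.V := {u | G.Edge u v}

/-- A directed graph is acyclic if no vertex reaches itself by a nonempty path. -/
def Acyclic (G : FinDigraph) : Prop := ∀ v, ¬ Relation.TransGen G.Edge v v

/-- A sink is a vertex with no outgoing edge. -/
def IsSink (G : FinDigraph) (z : G.V) : Prop := ∀ u, ¬ G.Edge z u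

/-- `z` is the unique sink of `G`. -/
def UniqueSink (G : FinDigraph) (z : G.V) : Prop :=
  G.IsSink z ∧ ∀ v, G.IsSink v → v = z

/-- One legal move of the reversible pebble game: place a pebble on a vertex all of whose
predecessors are pebbled, or remove a pebble from such a vertex. -/
def RevMove (G : FinDigraph) (P Q : Set G.V) : Prop :=
  ∃ v, G.pred v ⊆ P ∧
    ((v ∉ P ∧ Q = insert v P) ∨ (v ∈ P ∧ Q = P \ {v}))

/-- One legal move of the standard pebble game: place a pebble on a vertex all of whose
predecessors are pebbled, or remove a pebble from an arbitrary vertex. -/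
def StdMove (G : FinDigraph) (P Q : Set G.V) : Prop :=
  (∃ v, G.pred v ⊆ P ∧ v ∉ P ∧ Q = insert v P) ∨ (∃ v, v ∈ P ∧ Q = P \ {v})

/-- A reversible pebbling of `G` (with sink `z`) with time `t`. -/
def IsRevPebbling (G : FinDigraph) (z : G.V) (t : ℕ) (P : ℕ → Set G.V) : Prop :=
  P 0 = ∅ ∧ P t = ∅ ∧ (∃ i ≤ t, z ∈ P i) ∧ ∀ i < t, G.RevMove (P i) (P (i + 1))

/-- A standard pebbling of `G` (with sink `z`) with time `t`. -/
def IsStdPebbling (G : FinDigraph) (z : G.V) (t : ℕ) (P : ℕ → Set G.V) : Prop :=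
  P 0 = ∅ ∧ P t = ∅ ∧ (∃ i ≤ t, z ∈ P i) ∧ ∀ i < t, G.StdMove (P i) (P (i + 1))

/-- The space of a pebbling: the maximal number of pebbles in any configuration. -/
noncomputable def space (G : FinDigraph) (t : ℕ) (P : ℕ → Set G.V) : ℕ :=
  (Finset.range (t + 1)).sup fun i => (P i).ncard

end FinDigraph

section Generic

variable {α : Type} [DecidableEq α]

/-- Reversible reachability with time at most `t` and space at most `s`. -/
inductive Reach (E : α → α → Prop) (W : α → Prop) (s : ℕ) : ℕ → Finset α → Finset α → Prop
  | refl (t : ℕ) (P : Finset α) : P.card ≤ s → Reach E W s t P P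
  | put (t : ℕ) (v : α) (P Q : Finset α) : v ∉ P → W v → (∀ u, E u v → u ∈ P) →
      (insert v P).card ≤ s → Reach E W s t (insert v P) Q → Reach E W s (t + 1) P Q
  | del (t : ℕ) (v : α) (P Q : Finset α) : v ∉ P → W v → (∀ u, E u v → u ∈ P) →
      (insert v P).card ≤ s → Reach E W s t P Q → Reach E W s (t + 1) (insert v P) Q

variable {E : α → α → Prop} {W : α → Prop}

lemma Reach.mono {s s' t t' : ℕ} {P Q : Finset α} (h : Reach E W s t P Q) (hs : s ≤ s')
    (ht : t ≤ t') : Reach E W s' t' P Q := by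
  induction h generalizing t' with
  | refl t P h => exact .refl _ _ (h.trans hs)
  | put t v P Q h1 h2 h3 h4 _ ih =>
    obtain ⟨t', rfl⟩ : ∃ a, t' = a + 1 := ⟨t' - 1, by omega⟩
    exact .put _ v _ _ h1 h2 h3 (h4.trans hs) (ih (by omega))
  | del t v P Q h1 h2 h3 h4 _ ih =>
    obtain ⟨t', rfl⟩ : ∃ a, t' = a + 1 := ⟨t' - 1, by omega⟩
    exact .del _ v _ _ h1 h2 h3 (h4.trans hs) (ih (by omega))

lemma Reach.trans {s t t' : ℕ} {P Q R : Finset α} (h : Reach E W s t P Q)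
    (h' : Reach E W s t' Q R) : Reach E W s (t + t') P R := by
  induction h with
  | refl t P h => exact h'.mono le_rfl (by omega)
  | put t v P Q h1 h2 h3 h4 _ ih =>
    rw [Nat.add_right_comm]
    exact .put _ v _ _ h1 h2 h3 h4 (ih h')
  | del t v P Q h1 h2 h3 h4 _ ih =>
    rw [Nat.add_right_comm]
    exact .del _ v _ _ h1 h2 h3 h4 (ih h')

lemma Reach.single {s : ℕ} {v : α} {P : Finset α} (h1 : v ∉ P) (h2 : W v)
    (h3 : ∀ u, E u v → u ∈ P) (h4 : P.card + 1 ≤ s) : Reach E W s 1 P (insert v P) := by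
  have : (insert v P).card ≤ s := by rw [Finset.card_insert_of_notMem h1]; exact h4
  exact .put 0 v _ _ h1 h2 h3 this (.refl _ _ this)

lemma Reach.symm {s t : ℕ} {P Q : Finset α} (h : Reach E W s t P Q) : Reach E W s t Q P := by
  induction h with
  | refl t P h => exact .refl _ _ h
  | put t v P Q h1 h2 h3 h4 _ ih =>
    refine ih.trans (.del 0 v _ _ h1 h2 h3 h4 (.refl _ _ ?_))
    exact (Finset.card_le_card (Finset.subset_insert v P)).trans h4
  | del t v P Q h1 h2 h3 h4 _ ih =>
    exact ih.trans (.put 0 v _ _ h1 h2 h3 h4 (.refl _ _ h4))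

/-- Bennett-style pebbling of a segment of a path. -/
lemma path_seg (x : ℕ → α) (L : ℕ) (Good : Finset α → Prop)
    (hG : ∀ p < L, ∀ A, Good A → Good (insert (x p) A))
    (inj : ∀ p q, x p = x q → p = q) (σ τ : ℕ)
    (H : ∀ p < L, ∀ A, Good A → x p ∉ A → (p = 0 ∨ x (p - 1) ∈ A) →
      Reach E W (A.card + 1 + σ) τ A (insert (x p) A)) (m : ℕ) (hm : 1 ≤ m) :
    ∀ k a len A, 1 ≤ len → len ≤ m ^ k → a + len ≤ L → Good A →
      (∀ q, a ≤ q → q < a + len → x q ∉ A) → (a = 0 ∨ x (a - 1) ∈ A) →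
      Reach E W (A.card + k * (m - 1) + 1 + σ) ((2 * m - 1) ^ k * τ) A
        (insert (x (a + len - 1)) A) := by
  intro k
  induction k with
  | zero =>
    intro a len A h1 h2 h3 h4 h5 h6
    have : len = 1 := by simp at h2; omega
    subst this
    have := H a (by omega) A h4 (h5 a le_rfl (by omega)) h6
    simpa using this
  | succ k ih =>
    have key : ∀ q, q + 1 ≤ m → ∀ a len A, 1 ≤ len → len ≤ (q + 1) * m ^ k → a + len ≤ L →
        Good A → (∀ q, a ≤ q → q < a + len → x q ∉ A) → (a = 0 ∨ x (a - 1) ∈ A) →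
        Reach E W (A.card + k * (m - 1) + q + 1 + σ) ((2 * q + 1) * ((2 * m - 1) ^ k * τ)) A
          (insert (x (a + len - 1)) A) := by
      intro q
      induction q with
      | zero =>
        intro _ a len A h1 h2 h3 h4 h5 h6
        have := ih a len A h1 (by simpa using h2) h3 h4 h5 h6
        simpa using this
      | succ q ihq =>
        intro hq a len A h1 h2 h3 h4 h5 h6
        by_cases hl : len ≤ m ^ k
        · exact (ih a len A h1 hl h3 h4 h5 h6).mono (by omega) (by nlinarith [Nat.zero_le ((2 * m - 1) ^ k * τ)])
        push Not at hl
        have hmk : 1 ≤ m ^ k := Nat.one_le_pow _ _ hm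
        set M := m ^ k with hM
        have s1 := ih a M A hmk le_rfl (by omega) h4 (fun q a b => h5 q a (by omega)) h6
        have hn1 : x (a + M - 1) ∉ A := h5 _ (by omega) (by omega)
        have hn2 : x (a + len - 1) ∉ A := h5 _ (by omega) (by omega)
        have hne : x (a + len - 1) ≠ x (a + M - 1) := by
          intro h; have := inj _ _ h; omega
        have s2 := ihq (by omega) (a + M) (len - M) (insert (x (a + M - 1)) A) (by omega)
          (by have : (q + 1 + 1) * M = (q + 1) * M + M := by ring
              omega) (by omega) (hG _ (by omega) _ h4)
          (by
            intro p hp1 hp2 hp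
            rcases Finset.mem_insert.1 hp with h | h
            · have := inj _ _ h; omega
            · exact h5 p (by omega) (by omega) h) (Or.inr (by simp))
        have s3 := ih a M (insert (x (a + len - 1)) A) hmk le_rfl (by omega)
          (hG _ (by omega) _ h4)
          (by
            intro p hp1 hp2 hp
            rcases Finset.mem_insert.1 hp with h | h
            · have := inj _ _ h; omega
            · exact h5 p (by omega) (by omega) h)
          (by rcases h6 with h | h
              · exact Or.inl h
              · exact Or.inr (Finset.mem_insert_of_mem h))
        have e : a + M + (len - M) - 1 = a + len - 1 := by omega
        rw [e, Finset.card_insert_of_notMem hn1, Finset.insert_comm] at s2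
        rw [Finset.card_insert_of_notMem hn2] at s3
        have := ((s1.mono (s' := A.card + k * (m - 1) + (q + 1) + 1 + σ) (by omega) le_rfl).trans
          (s2.mono (by omega) le_rfl)).trans ((s3.symm).mono (by omega) le_rfl)
        refine this.mono le_rfl (le_of_eq ?_)
        ring
    intro a len A h1 h2 h3 h4 h5 h6
    obtain ⟨q, rfl⟩ : ∃ q, m = q + 1 := ⟨m - 1, by omega⟩
    have := key q le_rfl a len A h1 (by rw [pow_succ, mul_comm] at h2; exact h2) h3 h4 h5 h6
    refine this.mono ?_ ?_
    · have : (k + 1) * (q + 1 - 1) = k * (q + 1 - 1) + q := by simp; ring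
      omega
    · have : 2 * (q + 1) - 1 = 2 * q + 1 := by omega
      rw [this, pow_succ]
      apply le_of_eq; ring

end Generic

section Construction

/-- Ambient edge relation on triples (level, spine, position). -/
def tEdge (c : ℕ) (u v : ℕ × ℕ × ℕ) : Prop :=
  (u.1 = v.1 ∧ u.2.1 = v.2.1 ∧ u.2.2 + 1 = v.2.2) ∨
  (u.1 + 1 = v.1 ∧ u.2.1 = v.2.2 ∧ u.2.2 + 1 = c ∧ u.2.1 < c)

/-- Vertices: `r` levels with `c` spines of length `c`, and one final spine of length `n+1`. -/
def tVerts (r c n : ℕ) : Finset (ℕ × ℕ × ℕ) :=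
  (Finset.range r ×ˢ (Finset.range c ×ˢ Finset.range c)) ∪
    (({r} : Finset ℕ) ×ˢ (({0} : Finset ℕ) ×ˢ Finset.range (n + 1)))

lemma mem_tVerts {r c n i j p : ℕ} :
    (i, j, p) ∈ tVerts r c n ↔ (i < r ∧ j < c ∧ p < c) ∨ (i = r ∧ j = 0 ∧ p < n + 1) := by
  simp [tVerts]
  omega

lemma card_tVerts (r c n : ℕ) : (tVerts r c n).card = r * (c * c) + (n + 1) := by
  unfold tVerts
  rw [Finset.card_union_of_disjoint]
  · simp
  · rw [Finset.disjoint_left]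
    rintro ⟨i, j, p⟩ h1 h2
    simp at h1 h2
    omega

/-- The graph. -/
def tGraph (r c n : ℕ) : FinDigraph where
  V := {x : ℕ × ℕ × ℕ // x ∈ tVerts r c n}
  Edge u v := tEdge c u.1 v.1

/-- The sink. -/
def tSink (r c n : ℕ) : (tGraph r c n).V := ⟨(r, 0, n), by rw [mem_tVerts]; omega⟩

lemma tGraph_card (r c n : ℕ) :
    Fintype.card (tGraph r c n).V = r * (c * c) + (n + 1) := by
  rw [← card_tVerts]
  exact Fintype.card_coe _

lemma tGraph_acyclic (r c n : ℕ) : (tGraph r c n).Acyclic := by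
  intro v hv
  have : ∀ u w : (tGraph r c n).V, Relation.TransGen (tGraph r c n).Edge u w →
      (u.1.1 < w.1.1 ∨ (u.1.1 = w.1.1 ∧ u.1.2.2 < w.1.2.2)) := by
    have base : ∀ u w : (tGraph r c n).V, (tGraph r c n).Edge u w →
      (u.1.1 < w.1.1 ∨ (u.1.1 = w.1.1 ∧ u.1.2.2 < w.1.2.2)) := by
      intro u w h
      change tEdge c u.1 w.1 at h
      unfold tEdge at h
      omega
    intro u w h
    induction h with
    | single h => exact base _ _ h
    | tail _ h ih =>
      have := base _ _ h
      omega
  have := this v v hv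
  omega

lemma tGraph_sink (r c n : ℕ) (hc : c ≤ n + 1) :
    (tGraph r c n).UniqueSink (tSink r c n) := by
  constructor
  · rintro ⟨⟨i, j, p⟩, hu⟩ h
    change tEdge c (r, 0, n) (i, j, p) at h
    rw [mem_tVerts] at hu
    simp only [tEdge] at h
    omega
  · rintro ⟨⟨i, j, p⟩, hu⟩ h
    have hu' := hu
    rw [mem_tVerts] at hu'
    have h' : ∀ w, w ∈ tVerts r c n → ¬ tEdge c (i, j, p) w := fun w hw => h ⟨w, hw⟩
    apply Subtype.ext
    change (i, j, p) = (r, 0, n)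
    have h1 : (i, j, p + 1) ∉ tVerts r c n := fun hw => h' _ hw (by simp [tEdge])
    have h2 : p + 1 = c → j < c → (i + 1, 0, j) ∉ tVerts r c n := fun e e' hw =>
      h' _ hw (by simp [tEdge, e, e'])
    rw [mem_tVerts] at h1 h2
    simp only [Prod.mk.injEq]
    rcases hu' with ⟨q1, q2, q3⟩ | q
    · exfalso
      have e : p + 1 = c := by omega
      have := h2 e q2
      omega
    · omega

lemma tGraph_indeg (r c n : ℕ) (v : (tGraph r c n).V) :
    ((tGraph r c n).pred v).ncard ≤ 2 := by
  have inj : Function.Injective (fun x : (tGraph r c n).V => x.1) := Subtype.val_injective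
  rw [← Set.ncard_image_of_injective _ inj]
  refine (Set.ncard_le_ncard (t := {(v.1.1, v.1.2.1, v.1.2.2 - 1), (v.1.1 - 1, v.1.2.2, c - 1)})
    ?_ (Set.toFinite _)).trans ((Set.ncard_insert_le _ _).trans (by simp))
  rintro _ ⟨⟨⟨i, j, p⟩, hu⟩, h, rfl⟩
  change tEdge c (i, j, p) v.1 at h
  simp only [tEdge] at h
  simp only [Set.mem_insert_iff, Set.mem_singleton_iff, Prod.mk.injEq]
  omega

/-- Restriction of an ambient configuration to the graph. -/
def cfg (r c n : ℕ) (A : Finset (ℕ × ℕ × ℕ)) : Set (tGraph r c n).V := {v | v.1 ∈ A}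

lemma cfg_ncard (r c n : ℕ) (A : Finset (ℕ × ℕ × ℕ)) : (cfg r c n A).ncard ≤ A.card := by
  have inj : Function.Injective (fun x : (tGraph r c n).V => x.1) := Subtype.val_injective
  rw [← Set.ncard_image_of_injective _ inj, ← Set.ncard_coe_finset]
  refine Set.ncard_le_ncard ?_ (Set.toFinite _)
  rintro _ ⟨x, hx, rfl⟩
  exact hx

abbrev TReach (r c n : ℕ) := Reach (tEdge c) (fun x => x ∈ tVerts r c n)

lemma cfg_move (r c n : ℕ) (v : ℕ × ℕ × ℕ) (P : Finset (ℕ × ℕ × ℕ)) (h1 : v ∉ P)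
    (h2 : v ∈ tVerts r c n) (h3 : ∀ u, tEdge c u v → u ∈ P) :
    (tGraph r c n).RevMove (cfg r c n P) (cfg r c n (insert v P)) ∧
    (tGraph r c n).RevMove (cfg r c n (insert v P)) (cfg r c n P) := by
  obtain ⟨w, hw⟩ : ∃ w : (tGraph r c n).V, w.1 = v := ⟨⟨v, h2⟩, rfl⟩
  have e : cfg r c n (insert v P) = insert w (cfg r c n P) := by
    ext x
    rw [Set.mem_insert_iff]
    change x.1 ∈ insert v P ↔ x = w ∨ x.1 ∈ P
    rw [Finset.mem_insert, ← hw]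
    exact or_congr_left ⟨fun h => Subtype.ext h, fun h => by rw [h]⟩
  have hn : w ∉ cfg r c n P := by
    change w.1 ∉ P
    rw [hw]; exact h1
  have hp : (tGraph r c n).pred w ⊆ cfg r c n P := fun u hu => h3 u.1 (hw ▸ hu)
  rw [e]
  refine ⟨⟨w, hp, Or.inl ⟨hn, rfl⟩⟩, ⟨w, hp.trans (Set.subset_insert _ _),
    Or.inr ⟨Set.mem_insert _ _, ?_⟩⟩⟩
  ext x
  simp only [Set.mem_sdiff, Set.mem_insert_iff, Set.mem_singleton_iff]
  constructor
  · intro h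
    exact ⟨Or.inr h, fun h' => hn (h' ▸ h)⟩
  · tauto

lemma reach_seq {r c n s t : ℕ} {P Q : Finset (ℕ × ℕ × ℕ)} (h : TReach r c n s t P Q) :
    ∃ t' ≤ t, ∃ f : ℕ → Finset (ℕ × ℕ × ℕ), f 0 = P ∧ f t' = Q ∧ (∀ i ≤ t', (f i).card ≤ s) ∧
      ∀ i < t', (tGraph r c n).RevMove (cfg r c n (f i)) (cfg r c n (f (i + 1))) ∧
        (tGraph r c n).RevMove (cfg r c n (f (i + 1))) (cfg r c n (f i)) := by
  have cons : ∀ (t t' : ℕ) (P P' Q : Finset (ℕ × ℕ × ℕ)) (f : ℕ → Finset (ℕ × ℕ × ℕ)),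
      t' ≤ t → f 0 = P' → f t' = Q → (∀ i ≤ t', (f i).card ≤ s) →
      (∀ i < t', (tGraph r c n).RevMove (cfg r c n (f i)) (cfg r c n (f (i + 1))) ∧
        (tGraph r c n).RevMove (cfg r c n (f (i + 1))) (cfg r c n (f i))) →
      P.card ≤ s →
      ((tGraph r c n).RevMove (cfg r c n P) (cfg r c n P') ∧
        (tGraph r c n).RevMove (cfg r c n P') (cfg r c n P)) →
      ∃ t'' ≤ t + 1, ∃ f : ℕ → Finset (ℕ × ℕ × ℕ), f 0 = P ∧ f t'' = Q ∧
        (∀ i ≤ t'', (f i).card ≤ s) ∧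
      ∀ i < t'', (tGraph r c n).RevMove (cfg r c n (f i)) (cfg r c n (f (i + 1))) ∧
        (tGraph r c n).RevMove (cfg r c n (f (i + 1))) (cfg r c n (f i)) := by
    intro t t' P P' Q f h1 h2 h3 h4 h5 h6 h7
    refine ⟨t' + 1, by omega, fun i => Nat.casesOn i P f, rfl, h3, ?_, ?_⟩
    · intro i hi
      cases i with
      | zero => exact h6
      | succ i => exact h4 i (by omega)
    · intro i hi
      cases i with
      | zero => change FinDigraph.RevMove _ _ (cfg r c n (f 0)) ∧ FinDigraph.RevMove _ (cfg r c n (f 0)) _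
                rw [h2]; exact h7
      | succ i => exact h5 i (by omega)
  induction h with
  | refl t P h => exact ⟨0, by omega, fun _ => P, rfl, rfl, fun _ _ => h, by omega⟩
  | put t v P Q h1 h2 h3 h4 _ ih =>
    obtain ⟨t', ht, f, a1, a2, a3, a4⟩ := ih
    exact cons t t' P _ Q f ht a1 a2 a3 a4
      ((Finset.card_le_card (Finset.subset_insert v P)).trans h4) (cfg_move r c n v P h1 h2 h3)
  | del t v P Q h1 h2 h3 h4 _ ih =>
    obtain ⟨t', ht, f, a1, a2, a3, a4⟩ := ih
    exact cons t t' _ P Q f ht a1 a2 a3 a4 h4 (cfg_move r c n v P h1 h2 h3).symm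

lemma reach_pebbling {r c n s t : ℕ} {Q : Finset (ℕ × ℕ × ℕ)} (h : TReach r c n s t ∅ Q)
    (hz : (r, 0, n) ∈ Q) :
    ∃ t' P, (tGraph r c n).IsRevPebbling (tSink r c n) t' P ∧ t' ≤ 2 * t ∧
      (tGraph r c n).space t' P ≤ s := by
  obtain ⟨t', ht, f, a1, a2, a3, a4⟩ := reach_seq h
  refine ⟨2 * t', fun i => cfg r c n (f (min i (2 * t' - i))), ⟨?_, ?_, ⟨t', by omega, ?_⟩, ?_⟩,
    by omega, ?_⟩
  · simp [a1, cfg]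
  · simp [a1, cfg]
  · have : min t' (2 * t' - t') = t' := by omega
    change (r, 0, n) ∈ f (min t' (2 * t' - t'))
    rw [this, a2]; exact hz
  · intro i hi
    by_cases hlt : i < t'
    · have e1 : min i (2 * t' - i) = i := by omega
      have e2 : min (i + 1) (2 * t' - (i + 1)) = i + 1 := by omega
      simp only [e1, e2]
      exact (a4 i hlt).1
    · have e1 : min i (2 * t' - i) = (2 * t' - i - 1) + 1 := by omega
      have e2 : min (i + 1) (2 * t' - (i + 1)) = 2 * t' - i - 1 := by omega
      simp only [e1, e2]
      exact (a4 _ (by omega)).2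
  · refine Finset.sup_le fun i hi => (cfg_ncard r c n _).trans (a3 _ (by omega))

/-- Low-space strategy for one spine. -/
lemma spine_low (r c n k i : ℕ)
    (hlow : i = 0 ∨ ∃ T, ∀ j < c, ∀ A : Finset (ℕ × ℕ × ℕ), (∀ u ∈ A, i - 1 < u.1) →
      TReach r c n (A.card + i * (k + 1)) T A (insert (i - 1, j, c - 1) A)) :
    ∃ T, ∀ j L, 1 ≤ L → L ≤ 2 ^ k → (∀ p < L, (i, j, p) ∈ tVerts r c n) →
      ∀ A : Finset (ℕ × ℕ × ℕ), (∀ u ∈ A, i < u.1) →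
      TReach r c n (A.card + (i + 1) * (k + 1)) T A (insert (i, j, L - 1) A) := by
  obtain ⟨T, hT⟩ : ∃ T, i = 0 ∨ ∀ j < c, ∀ A : Finset (ℕ × ℕ × ℕ), (∀ u ∈ A, i - 1 < u.1) →
      TReach r c n (A.card + i * (k + 1)) T A (insert (i - 1, j, c - 1) A) := by
    rcases hlow with h | ⟨T, h⟩
    · exact ⟨0, Or.inl h⟩
    · exact ⟨T, Or.inr h⟩
  refine ⟨(2 * 2 - 1) ^ k * (T + 1 + T), ?_⟩
  intro j L hL1 hL2 hW A hA
  have := path_seg (E := tEdge c) (W := fun x => x ∈ tVerts r c n) (fun p => (i, j, p)) L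
    (fun A => ∀ u ∈ A, i ≤ u.1)
    (by
      intro p hp A hA u hu
      rcases Finset.mem_insert.1 hu with h | h
      · simp [h]
      · exact hA u h)
    (by intro p q h; simpa using h) (i * (k + 1)) (T + 1 + T)
    (by
      intro p hp A hA hpA hpred
      by_cases hdir : i = 0 ∨ c ≤ p
      · refine (Reach.single hpA (hW p hp) ?_ le_rfl).mono (by omega) (by omega)
        rintro ⟨a, b, d⟩ h
        simp only [tEdge] at h
        rcases hpred with h0 | h0
        · omega
        · have : (a, b, d) = (i, j, p - 1) := by simp only [Prod.mk.injEq]; omega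
          rw [this]; exact h0
      · push Not at hdir
        rcases hT with h | hT
        · omega
        have hu : (i - 1, p, c - 1) ∉ A := fun h => by have := hA _ h; simp at this; omega
        have hu' : (i - 1, p, c - 1) ∉ insert (i, j, p) A := fun h => by
          rcases Finset.mem_insert.1 h with h | h
          · simp at h; omega
          · exact hu h
        have s1 := hT p hdir.2 A (fun u hu => by have := hA u hu; omega)
        have s3 := hT p hdir.2 (insert (i, j, p) A) (fun u hu => by
          rcases Finset.mem_insert.1 hu with h | h
          · simp [h]; omega
          · have := hA u h; omega)
        have hp' : (i, j, p) ∉ insert (i - 1, p, c - 1) A := fun h => by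
          rcases Finset.mem_insert.1 h with h | h
          · simp at h; omega
          · exact hpA h
        have hik : 1 ≤ i * (k + 1) := Nat.mul_pos (by omega) (by omega)
        have s2 : TReach r c n (A.card + 1 + i * (k + 1)) 1 _ _ :=
          Reach.single (v := (i, j, p)) hp' (hW p hp) (by
            rintro ⟨a, b, d⟩ h
            simp only [tEdge] at h
            by_cases hai : a = i
            · rcases hpred with h0 | h0
              · omega
              · have : (a, b, d) = (i, j, p - 1) := by simp only [Prod.mk.injEq]; omega
                rw [this]; exact Finset.mem_insert_of_mem h0
            · have : (a, b, d) = (i - 1, p, c - 1) := by simp only [Prod.mk.injEq]; omega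
              rw [this]; exact Finset.mem_insert_self _ _)
            (by rw [Finset.card_insert_of_notMem hu]; omega)
        rw [Finset.insert_comm] at s2
        rw [Finset.card_insert_of_notMem hpA] at s3
        exact ((s1.mono (by omega) le_rfl).trans s2).trans s3.symm)
    2 (by norm_num) k 0 L A hL1 hL2 (by omega) (fun u hu => (hA u hu).le)
    (fun q _ _ hq => by have := hA _ hq; simp at this) (Or.inl rfl)
  simp only [zero_add] at this
  refine this.mono (le_of_eq ?_) le_rfl
  ring

lemma low_reach (r c n k : ℕ) (hk : n + 1 ≤ 2 ^ k) (hc : c ≤ n + 1) :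
    ∃ T, TReach r c n ((r + 1) * (k + 1)) T ∅ {(r, 0, n)} := by
  have key : ∀ i, i ≤ r → (i = 0 ∨ ∃ T, ∀ j < c, ∀ A : Finset (ℕ × ℕ × ℕ),
      (∀ u ∈ A, i - 1 < u.1) →
      TReach r c n (A.card + i * (k + 1)) T A (insert (i - 1, j, c - 1) A)) := by
    intro i
    induction i with
    | zero => intro _; exact Or.inl rfl
    | succ i ih =>
      intro hi
      right
      obtain ⟨T, hT⟩ := spine_low r c n k i (ih (by omega))
      refine ⟨T, fun j hj A hA => hT j c (by omega) (by omega) ?_ A hA⟩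
      intro p hp
      rw [mem_tVerts]; omega
  obtain ⟨T, hT⟩ := spine_low r c n k r (key r le_rfl)
  refine ⟨T, ?_⟩
  have := hT 0 (n + 1) (by omega) hk (fun p hp => by rw [mem_tVerts]; omega) ∅ (by simp)
  simpa using this

/-- Fast strategy for one spine, when the ends of the preceding level are all pebbled. -/
lemma spine_high (r c n m k i j L : ℕ) (hm : 1 ≤ m) (hL1 : 1 ≤ L) (hL2 : L ≤ m ^ k)
    (hW : ∀ p < L, (i, j, p) ∈ tVerts r c n) (A : Finset (ℕ × ℕ × ℕ))
    (hA : 1 ≤ i → ∀ q < c, (i - 1, q, c - 1) ∈ A) (hA' : ∀ p < L, (i, j, p) ∉ A) :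
    TReach r c n (A.card + k * (m - 1) + 1) ((2 * m - 1) ^ k) A (insert (i, j, L - 1) A) := by
  have := path_seg (E := tEdge c) (W := fun x => x ∈ tVerts r c n) (fun p => (i, j, p)) L
    (fun A => 1 ≤ i → ∀ q < c, (i - 1, q, c - 1) ∈ A)
    (by
      intro p hp A hA h1 q hq
      exact Finset.mem_insert_of_mem (hA h1 q hq))
    (by intro p q h; simpa using h) 0 1
    (by
      intro p hp A hA hpA hpred
      refine (Reach.single hpA (hW p hp) ?_ le_rfl)
      rintro ⟨a, b, d⟩ h
      simp only [tEdge] at h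
      by_cases hai : a = i
      · rcases hpred with h0 | h0
        · omega
        · have : (a, b, d) = (i, j, p - 1) := by simp only [Prod.mk.injEq]; omega
          rw [this]; exact h0
      · have : (a, b, d) = (i - 1, p, c - 1) := by simp only [Prod.mk.injEq]; omega
        rw [this]; exact hA (by omega) p (by omega))
    m hm k 0 L A hL1 hL2 (by omega) hA (fun q _ hq => hA' q (by omega)) (Or.inl rfl)
  simpa using this

/-- All ends of the levels below `i`, and the first `j` ends of level `i`. -/
def endsCfg (c i j : ℕ) : Finset (ℕ × ℕ × ℕ) :=
  (Finset.range i ×ˢ (Finset.range c ×ˢ ({c - 1} : Finset ℕ))) ∪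
    (({i} : Finset ℕ) ×ˢ (Finset.range j ×ˢ ({c - 1} : Finset ℕ)))

lemma mem_endsCfg {c i j a b d : ℕ} :
    (a, b, d) ∈ endsCfg c i j ↔ (a < i ∧ b < c ∧ d = c - 1) ∨ (a = i ∧ b < j ∧ d = c - 1) := by
  simp [endsCfg]
  omega

lemma card_endsCfg (c i j : ℕ) : (endsCfg c i j).card ≤ i * c + j := by
  unfold endsCfg
  refine (Finset.card_union_le _ _).trans ?_
  simp

lemma endsCfg_reach (r c n : ℕ) : ∀ i ≤ r, TReach r c n (r * c + c) (i * (c * (2 * c))) ∅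
    (endsCfg c i 0) := by
  intro i
  induction i with
  | zero =>
    intro _
    have : endsCfg c 0 0 = ∅ := by simp [endsCfg]
    rw [this]
    exact .refl _ _ (by simp)
  | succ i ih =>
    intro hi
    have key : ∀ j ≤ c, TReach r c n (r * c + c) (j * (2 * c)) (endsCfg c i 0)
        (endsCfg c i j) := by
      intro j
      induction j with
      | zero =>
        intro _
        refine .refl _ _ ((card_endsCfg _ _ _).trans ?_)
        have : i * c ≤ r * c := Nat.mul_le_mul_right _ (by omega)
        omega
      | succ j ihj =>
        intro hj
        have h := spine_high r c n c 1 i j c (by omega) (by omega) (by simp)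
          (fun p hp => by rw [mem_tVerts]; omega) (endsCfg c i j)
          (fun h1 q hq => by rw [mem_endsCfg]; omega)
          (fun p hp => by rw [mem_endsCfg]; omega)
        have e : insert (i, j, c - 1) (endsCfg c i j) = endsCfg c i (j + 1) := by
          ext ⟨a, b, d⟩
          rw [Finset.mem_insert, mem_endsCfg, mem_endsCfg]
          simp only [Prod.mk.injEq]
          omega
        rw [e] at h
        have hcard := card_endsCfg c i j
        have h1 : (i + 1) * c ≤ r * c := Nat.mul_le_mul_right _ (by omega)
        have h2 : (i + 1) * c = i * c + c := by ring
        refine ((ihj (by omega)).trans (h.mono (by omega) le_rfl)).mono le_rfl ?_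
        have : (j + 1) * (2 * c) = j * (2 * c) + 2 * c := by ring
        simp only [pow_one]
        omega
    have e : endsCfg c i c = endsCfg c (i + 1) 0 := by
      ext ⟨a, b, d⟩
      rw [mem_endsCfg, mem_endsCfg]
      omega
    have h2 := key c le_rfl
    rw [e] at h2
    refine ((ih (by omega)).trans h2).mono le_rfl (le_of_eq ?_)
    ring

lemma high_reach (r c n m k : ℕ) (hm : 1 ≤ m) (hk : n + 1 ≤ m ^ k) :
    TReach r c n (r * c + c + k * (m - 1) + 1) (r * (c * (2 * c)) + (2 * m - 1) ^ k) ∅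
      (insert (r, 0, n) (endsCfg c r 0)) := by
  have h1 := endsCfg_reach r c n r le_rfl
  have h2 := spine_high r c n m k r 0 (n + 1) hm (by omega) hk
    (fun p hp => by rw [mem_tVerts]; omega) (endsCfg c r 0)
    (fun h1 q hq => by rw [mem_endsCfg]; omega)
    (fun p hp => by rw [mem_endsCfg]; omega)
  have hcard := card_endsCfg c r 0
  exact (h1.mono (by omega) le_rfl).trans (h2.mono (by omega) le_rfl)

end Construction

section Lower

open Classical in
/-- Ends of level `i` appearing during times `a ≤ τ < x`. -/
noncomputable def appear (Q : ℕ → Set (ℕ × ℕ × ℕ)) (c i a x : ℕ) : Finset ℕ :=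
  (Finset.range c).filter (fun p => ∃ τ, a ≤ τ ∧ τ < x ∧ (i, p, c - 1) ∈ Q τ)

lemma mem_appear {Q : ℕ → Set (ℕ × ℕ × ℕ)} {c i a x p : ℕ} :
    p ∈ appear Q c i a x ↔ p < c ∧ ∃ τ, a ≤ τ ∧ τ < x ∧ (i, p, c - 1) ∈ Q τ := by
  simp [appear]

/-- Grouping argument. -/
lemma group_lower (Q : ℕ → Set (ℕ × ℕ × ℕ)) (c i s t T : ℕ)
    (hfin : ∀ i, (Q i).Finite) (hcard : ∀ i ≤ t, (Q i).ncard ≤ s)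
    (hT : ∀ p < c, ∀ a b, a ≤ b → b ≤ t → (∀ q < c, (i, p, q) ∉ Q a) →
      (∃ τ, a ≤ τ ∧ τ ≤ b ∧ (i, p, c - 1) ∈ Q τ) → T ≤ b - a) :
    ∀ d a b, a ≤ b → b ≤ t → d * (s + 1) ≤ (appear Q c i a (b + 1)).card → d * T ≤ b - a := by
  intro d
  induction d with
  | zero => intro a b _ _ _; simp
  | succ d ih =>
    intro a b hab hbt hd
    have hex : ∃ x, s + 1 ≤ (appear Q c i a x).card := ⟨b + 1, by nlinarith⟩
    classical
    obtain ⟨x, hx, hxmin⟩ : ∃ x, s + 1 ≤ (appear Q c i a x).card ∧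
        ∀ y < x, (appear Q c i a y).card ≤ s :=
      ⟨Nat.find hex, Nat.find_spec hex, fun y hy => by have := Nat.find_min hex hy; omega⟩
    have hxb : x ≤ b + 1 := by
      by_contra h
      have := hxmin (b + 1) (by omega)
      nlinarith
    have hxa : a < x := by
      have : (appear Q c i a x).Nonempty := Finset.card_pos.1 (by omega)
      obtain ⟨p, hp⟩ := this
      obtain ⟨_, τ, _, _, _⟩ := mem_appear.1 hp
      omega
    obtain ⟨b', rfl⟩ : ∃ b', x = b' + 1 := ⟨x - 1, by omega⟩
    have hmin := hxmin b' (by omega)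
    obtain ⟨p, hp, hpe⟩ : ∃ p ∈ appear Q c i a (b' + 1), ∀ q < c, (i, p, q) ∉ Q a := by
      by_contra hcon
      push Not at hcon
      choose! f hf1 hf2 using hcon
      have h1 : (appear Q c i a (b' + 1)).card ≤ (hfin a).toFinset.card := by
        refine Finset.card_le_card_of_injOn (fun p => (i, p, f p)) ?_ ?_
        · intro p hp
          simpa using hf2 p hp
        · intro p _ q _ h
          simp at h
          exact h.1
      have h2 := hcard a (by omega)
      rw [Set.ncard_eq_toFinset_card _ (hfin a)] at h2
      omega
    obtain ⟨hpc, τ, h1, h2, h3⟩ := mem_appear.1 hp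
    have hTb := hT p hpc a b' (by omega) (by omega) hpe ⟨τ, h1, by omega, h3⟩
    have hsub : appear Q c i a (b + 1) ⊆ appear Q c i a b' ∪ appear Q c i b' (b + 1) := by
      intro p hp
      obtain ⟨hpc, τ, h1, h2, h3⟩ := mem_appear.1 hp
      rw [Finset.mem_union, mem_appear, mem_appear]
      by_cases h : τ < b'
      · exact Or.inl ⟨hpc, τ, h1, h, h3⟩
      · exact Or.inr ⟨hpc, τ, by omega, h2, h3⟩
    have hle := (Finset.card_le_card hsub).trans (Finset.card_union_le _ _)
    have e : (d + 1) * (s + 1) = d * (s + 1) + s + 1 := by ring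
    have := ih b' b (by omega) hbt (by omega)
    have e : (d + 1) * T = d * T + T := by ring
    omega

lemma level_lower (r c n s t D : ℕ) (Q : ℕ → Set (ℕ × ℕ × ℕ))
    (hfin : ∀ i, (Q i).Finite) (hcard : ∀ i ≤ t, (Q i).ncard ≤ s)
    (hplace : ∀ a τ u, a ≤ τ → τ ≤ t → u ∉ Q a → u ∈ Q τ → ∃ τ', a ≤ τ' ∧ τ' < τ ∧
      ∀ w ∈ tVerts r c n, tEdge c w u → w ∈ Q τ')
    (hD : D * (s + 1) ≤ c) :
    ∀ i ≤ r, ∀ j L, c ≤ L → (∀ p < L, (i, j, p) ∈ tVerts r c n) →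
      ∀ a b, a ≤ b → b ≤ t → (∀ p < L, (i, j, p) ∉ Q a) →
      (∃ τ, a ≤ τ ∧ τ ≤ b ∧ (i, j, L - 1) ∈ Q τ) → 1 ≤ L → D ^ i ≤ b - a := by
  intro i
  induction i with
  | zero =>
    intro _ j L hcL hV a b hab hbt hemp ⟨τ, h1, h2, h3⟩ hL
    have : τ ≠ a := by
      rintro rfl
      exact hemp (L - 1) (by omega) h3
    simp; omega
  | succ i ih =>
    intro hi j L hcL hV a b hab hbt hemp hτ hL
    have all : ∀ q < L, ∃ τ, a ≤ τ ∧ τ ≤ b ∧ (i + 1, j, L - 1 - q) ∈ Q τ := by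
      intro q
      induction q with
      | zero => intro _; exact hτ
      | succ q ihq =>
        intro hq
        obtain ⟨τ, h1, h2, h3⟩ := ihq (by omega)
        obtain ⟨τ', h4, h5, h6⟩ := hplace a τ _ h1 (by omega) (hemp _ (by omega)) h3
        refine ⟨τ', h4, by omega, h6 _ (hV _ (by omega)) (Or.inl ⟨rfl, rfl, ?_⟩)⟩
        simp only
        omega
    have ends : ∀ p < c, p ∈ appear Q c i a (b + 1) := by
      intro p hp
      obtain ⟨τ, h1, h2, h3⟩ := all (L - 1 - p) (by omega)
      have e : L - 1 - (L - 1 - p) = p := by omega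
      rw [e] at h3
      obtain ⟨τ', h4, h5, h6⟩ := hplace a τ _ h1 (by omega) (hemp _ (by omega)) h3
      rw [mem_appear]
      refine ⟨hp, τ', h4, by omega, h6 _ (by rw [mem_tVerts]; omega) (Or.inr ⟨rfl, rfl, ?_, hp⟩)⟩
      simp only
      omega
    have hc : c ≤ (appear Q c i a (b + 1)).card := by
      have : Finset.range c ⊆ appear Q c i a (b + 1) := fun p hp => ends p (Finset.mem_range.1 hp)
      simpa using Finset.card_le_card this
    have := group_lower Q c i s t (D ^ i) hfin hcard
      (fun p hp a b hab hbt hemp hτ => ih (by omega) p c le_rfl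
        (fun q hq => by rw [mem_tVerts]; omega) a b hab hbt hemp hτ (by omega))
      D a b hab hbt (hD.trans hc)
    rw [pow_succ, mul_comm]
    exact this

lemma std_lower (r c n t D : ℕ) (hc : c ≤ n + 1) (P : ℕ → Set (tGraph r c n).V)
    (hP : (tGraph r c n).IsStdPebbling (tSink r c n) t P)
    (hD : D * ((tGraph r c n).space t P + 1) ≤ c) : D ^ r ≤ t := by
  obtain ⟨h0, ht, ⟨i, hi, hz⟩, hmove⟩ := hP
  have inj : Function.Injective (fun x : (tGraph r c n).V => x.1) := Subtype.val_injective
  have := level_lower r c n ((tGraph r c n).space t P) t D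
    (fun i => (fun x : (tGraph r c n).V => x.1) '' P i)
    (fun i => Set.toFinite _)
    (fun i hi => by
      rw [Set.ncard_image_of_injective _ inj]
      exact Finset.le_sup (f := fun i => (P i).ncard) (Finset.mem_range.2 (by omega)))
    (by
      intro a τ u ha
      induction τ, ha using Nat.le_induction with
      | base => intro _ h1 h2; exact absurd h2 h1
      | succ τ hτ ih =>
        intro htt h1 h2
        by_cases h3 : u ∈ (fun x : (tGraph r c n).V => x.1) '' P τ
        · obtain ⟨τ', q1, q2, q3⟩ := ih (by omega) h1 h3
          exact ⟨τ', q1, by omega, q3⟩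
        · refine ⟨τ, hτ, by omega, ?_⟩
          intro w hw hwu
          obtain ⟨x, hx, rfl⟩ := h2
          have hx' : x ∉ P τ := fun h => h3 ⟨x, h, rfl⟩
          rcases hmove τ (by omega) with ⟨v, hv1, hv2, hv3⟩ | ⟨v, hv1, hv2⟩
          · rw [hv3] at hx
            rcases hx with rfl | hx
            · exact ⟨⟨w, hw⟩, hv1 hwu, rfl⟩
            · exact absurd hx hx'
          · rw [hv2] at hx
            exact absurd hx.1 hx')
    hD r le_rfl 0 (n + 1) hc (fun p hp => by rw [mem_tVerts]; omega) 0 t (by omega) le_rfl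
    (by rw [h0]; simp) ⟨i, by omega, hi, tSink r c n, hz, rfl⟩ (by omega)
  simpa using this

lemma std_space_pos (r c n t : ℕ) (P : ℕ → Set (tGraph r c n).V)
    (hP : (tGraph r c n).IsStdPebbling (tSink r c n) t P) :
    1 ≤ (tGraph r c n).space t P := by
  obtain ⟨h0, ht, ⟨i, hi, hz⟩, hmove⟩ := hP
  have h1 : (P i).ncard ≤ (tGraph r c n).space t P :=
    Finset.le_sup (f := fun i => (P i).ncard) (Finset.mem_range.2 (by omega))
  have : 0 < (P i).ncard := (Set.ncard_pos (Set.toFinite _)).2 ⟨_, hz⟩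
  omega

end Lower

section Final

lemma size_bound (g n : ℕ) :
    min (g / 4) (Nat.log 2 n) * ((Nat.sqrt n / g) * (Nat.sqrt n / g)) ≤ n := by
  set c := Nat.sqrt n / g
  have h1 : g * c ≤ Nat.sqrt n := Nat.mul_div_le _ _
  have h2 : c ≤ Nat.sqrt n := Nat.div_le_self _ _
  have h3 : min (g / 4) (Nat.log 2 n) ≤ g := (min_le_left _ _).trans (Nat.div_le_self _ _)
  calc _ ≤ g * (c * c) := Nat.mul_le_mul_right _ h3
    _ = (g * c) * c := by ring
    _ ≤ Nat.sqrt n * Nat.sqrt n := Nat.mul_le_mul h1 h2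
    _ ≤ n := Nat.sqrt_le n

lemma c_le (g n : ℕ) : Nat.sqrt n / g ≤ n + 1 :=
  (Nat.div_le_self _ _).trans ((Nat.sqrt_le_self n).trans (Nat.le_succ n))

lemma quarter (n : ℕ) : ((n : ℝ) ^ ((1 : ℝ) / 4)) ^ 4 = n ∧
    (n : ℝ) ^ ((1 : ℝ) / 2) = ((n : ℝ) ^ ((1 : ℝ) / 4)) ^ 2 := by
  have hn : (0 : ℝ) ≤ n := Nat.cast_nonneg n
  constructor
  · rw [← Real.rpow_natCast, ← Real.rpow_mul hn]; norm_num
  · rw [← Real.rpow_natCast, ← Real.rpow_mul hn]; norm_num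

lemma part_one (g n : ℕ) (hg : 4 ≤ g) (hn : 4 ≤ n) :
    ((min (g / 4) (Nat.log 2 n) + 1 : ℕ) : ℝ) * ((Nat.log 2 n + 1 + 1 : ℕ) : ℝ) ≤
      (g : ℝ) * Real.logb 2 n := by
  have h1 : (Nat.log 2 n : ℝ) ≤ Real.logb 2 n := by
    have := Real.natLog_le_logb n 2
    exact_mod_cast this
  have h2 : (2 : ℝ) ≤ Nat.log 2 n := by
    have : 2 ≤ Nat.log 2 n := (Nat.le_log_iff_pow_le (by norm_num) (by omega)).2 (by omega)
    exact_mod_cast this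
  have h3 : ((min (g / 4) (Nat.log 2 n) : ℕ) : ℝ) ≤ g / 4 := by
    have : min (g / 4) (Nat.log 2 n) * 4 ≤ g := by omega
    have : ((min (g / 4) (Nat.log 2 n) : ℕ) : ℝ) * 4 ≤ g := by exact_mod_cast this
    linarith
  have h4 : (4 : ℝ) ≤ g := by exact_mod_cast hg
  rw [Nat.cast_add (min (g / 4) (Nat.log 2 n)) 1]
  rw [Nat.cast_add (Nat.log 2 n + 1) 1, Nat.cast_add (Nat.log 2 n) 1]
  calc _ ≤ ((g : ℝ) / 2) * (2 * Real.logb 2 n) := by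
        apply mul_le_mul
        · push_cast at h3 ⊢; linarith
        · push_cast; linarith
        · positivity
        · positivity
    _ = _ := by ring

lemma part_two (g n : ℕ) (hg : 1 ≤ g) (hn : 2 ≤ n)
    (hb : (g : ℝ) ≤ (n : ℝ) ^ ((1 : ℝ) / 4)) (ε : ℝ) (hε : 0 < ε) :
    ∃ t P, (tGraph (min (g / 4) (Nat.log 2 n)) (Nat.sqrt n / g) n).IsRevPebbling
        (tSink _ _ n) t P ∧
      (t : ℝ) ≤ 300000 * (n : ℝ) ^ ((1 : ℝ) + ε) ∧
      ((tGraph (min (g / 4) (Nat.log 2 n)) (Nat.sqrt n / g) n).space t P : ℝ) ≤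
        300000 * (n : ℝ) ^ ((1 : ℝ) / 2) * Real.logb 2 n / (g : ℝ) := by
  have hsz := size_bound g n
  have hcg : g * (Nat.sqrt n / g) ≤ Nat.sqrt n := Nat.mul_div_le _ _
  set r := min (g / 4) (Nat.log 2 n) with hr
  set c := Nat.sqrt n / g with hc
  obtain ⟨hq4, hq2⟩ := quarter n
  set q := (n : ℝ) ^ ((1 : ℝ) / 4) with hq
  have hq0 : 0 ≤ q := by positivity
  have hn2 : (2 : ℝ) ≤ n := by exact_mod_cast hn
  set y := ((n : ℝ) + 1) ^ ((1 : ℝ) / 8) with hy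
  have hy0 : 0 ≤ y := by positivity
  have hy8 : y ^ 8 = n + 1 := by
    rw [hy, ← Real.rpow_natCast, ← Real.rpow_mul (by positivity)]; norm_num
  have hy1 : 1 ≤ y := by
    apply Real.one_le_rpow <;> linarith
  have hyq : y ≤ q := by
    have : y ^ 8 ≤ q ^ 8 := by
      have : q ^ 8 = (n : ℝ) ^ 2 := by rw [← hq4]; ring
      rw [this, hy8]; nlinarith
    exact le_of_pow_le_pow_left₀ (by norm_num) hq0 this
  set m := ⌈y⌉₊ with hm
  have hm1 : y ≤ m := Nat.le_ceil y
  have hm2 : (m : ℝ) < y + 1 := Nat.ceil_lt_add_one hy0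
  have hm0 : 1 ≤ m := by
    have : (1 : ℝ) ≤ m := hy1.trans hm1
    exact_mod_cast this
  have hk : n + 1 ≤ m ^ 8 := by
    have : y ^ 8 ≤ (m : ℝ) ^ 8 := pow_le_pow_left₀ hy0 hm1 8
    rw [hy8] at this
    exact_mod_cast this
  obtain ⟨t, P, h1, h2, h3⟩ := reach_pebbling (high_reach r c n m 8 hm0 hk)
    (Finset.mem_insert_self _ _)
  refine ⟨t, P, h1, ?_, ?_⟩
  · have e1 : (t : ℝ) ≤ 2 * ((r : ℝ) * (c * (2 * c)) + (2 * m) ^ 8) := by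
      have : t ≤ 2 * (r * (c * (2 * c)) + (2 * m) ^ 8) := by
        refine h2.trans (Nat.mul_le_mul_left _ (Nat.add_le_add_left ?_ _))
        exact Nat.pow_le_pow_left (by omega) 8
      exact_mod_cast this
    have e2 : (r : ℝ) * (c * c) ≤ n := by exact_mod_cast hsz
    have e3 : (2 * (m : ℝ)) ^ 8 ≤ 65536 * (n + 1) := by
      calc (2 * (m : ℝ)) ^ 8 ≤ (4 * y) ^ 8 := pow_le_pow_left₀ (by positivity) (by linarith) 8
        _ = 65536 * (n + 1) := by rw [mul_pow, hy8]; norm_num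
    have e4 : (n : ℝ) ≤ (n : ℝ) ^ ((1 : ℝ) + ε) := by
      conv_lhs => rw [← Real.rpow_one (n : ℝ)]
      exact Real.rpow_le_rpow_of_exponent_le (by linarith) (by linarith)
    nlinarith
  · have hg0 : (0 : ℝ) < g := by exact_mod_cast hg
    rw [hq2, le_div_iff₀ hg0]
    have hl : (Nat.log 2 n : ℝ) ≤ Real.logb 2 n := by
      have := Real.natLog_le_logb n 2
      exact_mod_cast this
    have hl1 : (1 : ℝ) ≤ Nat.log 2 n := by
      have : 1 ≤ Nat.log 2 n := (Nat.le_log_iff_pow_le (by norm_num) (by omega)).2 (by omega)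
      exact_mod_cast this
    have hrl : (r : ℝ) ≤ Real.logb 2 n := by
      have : r ≤ Nat.log 2 n := min_le_right _ _
      have : (r : ℝ) ≤ Nat.log 2 n := by exact_mod_cast this
      linarith
    have hcq : (c : ℝ) * g ≤ q ^ 2 := by
      have a1 : (g : ℝ) * c ≤ (Nat.sqrt n : ℝ) := by exact_mod_cast hcg
      have a2 : ((Nat.sqrt n : ℕ) : ℝ) ^ 2 ≤ (q ^ 2) ^ 2 := by
        have : Nat.sqrt n ^ 2 ≤ n := Nat.sqrt_le' n
        have : ((Nat.sqrt n : ℕ) : ℝ) ^ 2 ≤ n := by exact_mod_cast this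
        calc _ ≤ (n : ℝ) := this
          _ = _ := by rw [← hq4]; ring
      have := le_of_pow_le_pow_left₀ (by norm_num) (by positivity) a2
      linarith
    have hsp : ((tGraph r c n).space t P : ℝ) ≤ r * c + c + 9 * q := by
      have : (((tGraph r c n).space t P + 7 : ℕ) : ℝ) ≤ ((r * c + c + 8 * m : ℕ) : ℝ) := by
        have : (tGraph r c n).space t P + 7 ≤ r * c + c + 8 * m := by omega
        exact_mod_cast this
      push_cast at this
      linarith
    set ℓ := Real.logb 2 n with hℓ
    have hℓ1 : 1 ≤ ℓ := by linarith
    have hqq : 0 ≤ q ^ 2 := by positivity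
    have b1 : (r : ℝ) * (c * g) ≤ ℓ * q ^ 2 := mul_le_mul hrl hcq (by positivity) (by positivity)
    have b2 : q * g ≤ q ^ 2 := by nlinarith
    have b3 : q ^ 2 ≤ ℓ * q ^ 2 := by nlinarith
    calc ((tGraph r c n).space t P : ℝ) * g ≤ (r * c + c + 9 * q) * g :=
          mul_le_mul_of_nonneg_right hsp hg0.le
      _ = r * (c * g) + c * g + 9 * (q * g) := by ring
      _ ≤ 11 * (ℓ * q ^ 2) := by linarith
      _ ≤ 300000 * q ^ 2 * ℓ := by nlinarith

lemma part_three (g n k r c : ℕ) (hcg : Nat.sqrt n < g * (c + 1)) (hc : c ≤ n + 1) (δ : ℝ) (hδ : 0 < δ) (hg : 1 ≤ g) (hn : 256 ≤ n)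
    (hb : (g : ℝ) ≤ (n : ℝ) ^ ((1 : ℝ) / 4))
    (hr : (k : ℝ) < δ * (r : ℝ)) (t : ℕ)
    (P : ℕ → Set (tGraph r c n).V)
    (hP : (tGraph r c n).IsStdPebbling
        (tSink _ _ n) t P)
    (hs : ((tGraph r c n).space t P : ℝ) ≤
      (1 / 16) * (n : ℝ) ^ ((1 : ℝ) / 2 - δ) / (g : ℝ)) :
    (n : ℝ) ^ k < (t : ℝ) := by
  have hs1 := std_space_pos _ _ _ _ _ hP
  have hlow := fun D => std_lower _ _ _ _ D hc _ hP
  set s := (tGraph r c n).space t P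
  obtain ⟨hq4, hq2⟩ := quarter n
  have hn2 : (256 : ℝ) ≤ n := by exact_mod_cast hn
  have hn0 : (0 : ℝ) < n := by linarith
  rw [Real.rpow_sub hn0, hq2] at hs
  set q := (n : ℝ) ^ ((1 : ℝ) / 4) with hq
  have hq0 : 0 ≤ q := by positivity
  have hqge : 4 ≤ q := by
    refine le_of_pow_le_pow_left₀ (n := 4) (by norm_num) hq0 ?_
    rw [hq4]; linarith
  have hg0 : (0 : ℝ) < g := by exact_mod_cast hg
  set w := (n : ℝ) ^ δ with hw
  have hw1 : 1 ≤ w := Real.one_le_rpow (by linarith) hδ.le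
  have hw0 : 0 < w := by linarith
  rw [le_div_iff₀ hg0, ← mul_div_assoc, le_div_iff₀ hw0] at hs
  have hcq : q ^ 2 ≤ g * (c + 1) := by
    have a1 : ((Nat.sqrt n : ℕ) : ℝ) + 1 ≤ g * (c + 1) := by exact_mod_cast hcg
    have a2 : (q ^ 2) ^ 2 ≤ (((Nat.sqrt n : ℕ) : ℝ) + 1) ^ 2 := by
      have : n < (Nat.sqrt n + 1) ^ 2 := Nat.lt_succ_sqrt' n
      have : (n : ℝ) ≤ (((Nat.sqrt n : ℕ) : ℝ) + 1) ^ 2 := by exact_mod_cast this.le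
      calc _ = (n : ℝ) := by rw [← hq4]; ring
        _ ≤ _ := this
    have := le_of_pow_le_pow_left₀ (by norm_num) (by positivity) a2
    linarith
  have hcq2 : q ^ 2 / 2 ≤ c * g := by nlinarith
  have hs1' : (1 : ℝ) ≤ s := by exact_mod_cast hs1
  have hDlow := hlow (c / (s + 1)) (Nat.div_mul_le_self _ _)
  have hDc : c < (s + 1) * (c / (s + 1) + 1) := Nat.lt_mul_div_succ _ (by omega)
  set D := c / (s + 1) with hDdef
  have hDw : w ≤ D := by
    by_contra hcon
    push Not at hcon
    have b1 : (c : ℝ) < (s + 1) * (D + 1) := by exact_mod_cast hDc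
    have b2 : (c : ℝ) < (2 * s) * (2 * w) := by
      refine b1.trans_le (mul_le_mul (by linarith) (by linarith) (by positivity) (by positivity))
    have b3 : (c : ℝ) * g < (2 * s) * (2 * w) * g := mul_lt_mul_of_pos_right b2 hg0
    nlinarith
  calc (n : ℝ) ^ k = (n : ℝ) ^ (k : ℝ) := (Real.rpow_natCast _ _).symm
    _ < (n : ℝ) ^ (δ * (r : ℝ)) := Real.rpow_lt_rpow_of_exponent_lt (by linarith) hr
    _ = w ^ r := by rw [Real.rpow_mul hn0.le, Real.rpow_natCast]
    _ ≤ (D : ℝ) ^ r := pow_le_pow_left₀ hw0.le hDw r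
    _ ≤ t := by exact_mod_cast hDlow

end Final

/-- For any constant `δ > 0` and any monotone nondecreasing `g : ℕ → ℕ` with
`g(n) → ∞` and `g(n) ≤ n^{1/4}`, there is a family of single-sink DAGs `G_n` of in-degree at
most 2 and `Θ(n)` vertices such that: (1) the reversible pebbling price of `G_n` is at most
`g(n) log n`; (2) for every `ε > 0` there is a reversible pebbling with time `O(n^{1+ε})` and
space `O(n^{1/2} log n / g(n))`; (3) there is a `K > 0` such that every standard pebbling with
space at most `K n^{1/2-δ} / g(n)` has superpolynomial time. -/
theorem reversible_pebbling_small_space_tradeoff (δ : ℝ) (hδ : 0 < δ) (g : ℕ → ℕ)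
    (hmono : Monotone g) (hinf : Filter.Tendsto g Filter.atTop Filter.atTop)
    (hbound : ∀ n : ℕ, 1 ≤ n → (g n : ℝ) ≤ (n : ℝ) ^ ((1 : ℝ) / 4)) :
    ∃ (G : ℕ → FinDigraph) (z : ∀ n, (G n).V),
      (∀ n, (G n).Acyclic ∧ (G n).UniqueSink (z n) ∧ ∀ v, ((G n).pred v).ncard ≤ 2) ∧
      (∃ a b : ℝ, 0 < a ∧ 0 < b ∧ ∀ n : ℕ, 1 ≤ n →
        a * n ≤ (Fintype.card (G n).V : ℝ) ∧ (Fintype.card (G n).V : ℝ) ≤ b * n) ∧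
      -- (1) reversible pebbling price at most g(n) log n
      (∃ N : ℕ, ∀ n : ℕ, N ≤ n →
        ∃ t P, (G n).IsRevPebbling (z n) t P ∧
          ((G n).space t P : ℝ) ≤ (g n : ℝ) * Real.logb 2 n) ∧
      -- (2) time O(n^{1+ε}) and space O(n^{1/2} log n / g(n))
      (∀ ε : ℝ, 0 < ε → ∃ C : ℝ, 0 < C ∧ ∃ N : ℕ, ∀ n : ℕ, N ≤ n →
        ∃ t P, (G n).IsRevPebbling (z n) t P ∧
          (t : ℝ) ≤ C * (n : ℝ) ^ ((1 : ℝ) + ε) ∧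
          ((G n).space t P : ℝ) ≤ C * (n : ℝ) ^ ((1 : ℝ) / 2) * Real.logb 2 n / (g n : ℝ)) ∧
      -- (3) superpolynomial time for standard pebblings of space K n^{1/2-δ} / g(n)
      (∃ K : ℝ, 0 < K ∧ ∀ k : ℕ, ∃ N : ℕ, ∀ n : ℕ, N ≤ n →
        ∀ t P, (G n).IsStdPebbling (z n) t P →
          ((G n).space t P : ℝ) ≤ K * (n : ℝ) ^ ((1 : ℝ) / 2 - δ) / (g n : ℝ) →
          (n : ℝ) ^ k < (t : ℝ)) := by
  refine ⟨fun n => tGraph (min (g n / 4) (Nat.log 2 n)) (Nat.sqrt n / g n) n,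
    fun n => tSink _ _ n, ?_, ?_, ?_, ?_, ?_⟩
  · intro n
    exact ⟨tGraph_acyclic _ _ _, tGraph_sink _ _ _ (c_le _ _), tGraph_indeg _ _ _⟩
  · refine ⟨1, 3, by norm_num, by norm_num, ?_⟩
    intro n hn
    simp only [tGraph_card]
    have h := size_bound (g n) n
    constructor
    · rw [one_mul]
      exact_mod_cast (by omega : n ≤ min (g n / 4) (Nat.log 2 n) *
        (Nat.sqrt n / g n * (Nat.sqrt n / g n)) + (n + 1))
    · exact_mod_cast (by omega : min (g n / 4) (Nat.log 2 n) *
        (Nat.sqrt n / g n * (Nat.sqrt n / g n)) + (n + 1) ≤ 3 * n)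
  · obtain ⟨N, hN⟩ := Filter.eventually_atTop.1 (hinf.eventually_ge_atTop 4)
    refine ⟨max N 4, fun n hn => ?_⟩
    obtain ⟨T, hT⟩ := low_reach (min (g n / 4) (Nat.log 2 n)) (Nat.sqrt n / g n) n
      (Nat.log 2 n + 1) (Nat.lt_pow_succ_log_self (by norm_num) n) (c_le _ _)
    obtain ⟨t, P, h1, _, h3⟩ := reach_pebbling hT (Finset.mem_singleton_self _)
    refine ⟨t, P, h1, ?_⟩
    refine le_trans ?_ (part_one (g n) n (hN n (le_of_max_le_left hn)) (le_of_max_le_right hn))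
    rw [← Nat.cast_mul]
    exact Nat.cast_le.2 h3
  · intro ε hε
    obtain ⟨N, hN⟩ := Filter.eventually_atTop.1 (hinf.eventually_ge_atTop 1)
    refine ⟨300000, by norm_num, max N 2, fun n hn => ?_⟩
    have h2 := le_of_max_le_right hn
    exact part_two (g n) n (hN n (le_of_max_le_left hn)) h2 (hbound n (by omega)) ε hε
  · refine ⟨1 / 16, by norm_num, fun k => ?_⟩
    obtain ⟨R, hR⟩ := exists_nat_gt ((k : ℝ) / δ)
    obtain ⟨N, hN⟩ := Filter.eventually_atTop.1 (hinf.eventually_ge_atTop (4 * (R + 1)))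
    refine ⟨max N (max 256 (2 ^ R)), fun n hn t P hP hs => ?_⟩
    have h1 := hN n (le_of_max_le_left hn)
    have h2 := le_of_max_le_left (le_of_max_le_right hn)
    have h3 := le_of_max_le_right (le_of_max_le_right hn)
    have h4 : R ≤ Nat.log 2 n := (Nat.le_log_iff_pow_le (by norm_num) (by omega)).2 h3
    have h5 : R ≤ min (g n / 4) (Nat.log 2 n) := le_min (by omega) h4
    refine part_three (g n) n k _ _ (Nat.lt_mul_div_succ _ (by omega)) (c_le _ _) δ hδ (by omega) h2 (hbound n (by omega)) ?_ t P hP hs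
    have h6 : (R : ℝ) ≤ ((min (g n / 4) (Nat.log 2 n) : ℕ) : ℝ) := by exact_mod_cast h5
    have h7 := (div_lt_iff₀ hδ).1 hR
    nlinarith
end

section
/- There is a family {G_n} of DAGs, each with a unique sink and maximum in-degree 2, where G_n has Θ(n) vertices, such that: (1) the reversible pebbling price of G_n is O(log² n); (2) for every constant δ > 0 there is a reversible pebbling of G_n with time O(n) and space O(n / log^{1−δ} n); and (3) there is a constant K > 0 such that every standard pebbling of G_n with space at most K·n/log n has time n^{Ω(log log n)} (i.e., at least n^{c·log log n} for some constant c > 0 and all sufficiently large n). -/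
open MvPolynomial

section Expander
open Finset Equiv

theorem perm_count {α : Type*} [Fintype α] [DecidableEq α] (W X : Finset α) :
    (univ.filter fun π : Perm α => ∀ x ∈ X, π x ∈ W).card * (Fintype.card α) ^ X.card
      ≤ W.card ^ X.card * (Fintype.card α).factorial := by
  induction X using Finset.induction_on with
  | empty => simp [Fintype.card_perm]
  | insert x X hx ih =>
    set f := (univ.filter fun π : Perm α => ∀ x ∈ X, π x ∈ W).card with hf
    set g := (univ.filter fun π : Perm α => ∀ z ∈ insert x X, π z ∈ W).card with hg
    have key : g * Fintype.card α ≤ f * W.card := by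
      have h1 : ∀ y : α, g ≤
          (univ.filter fun π : Perm α => (∀ x ∈ X, π x ∈ W) ∧ π y ∈ W).card := by
        intro y
        by_cases hy : y ∈ X
        · apply card_le_card
          intro π hπ
          simp only [mem_filter, mem_univ, true_and, mem_insert] at hπ ⊢
          exact ⟨fun z hz => hπ z (Or.inr hz), hπ y (Or.inr hy)⟩
        · apply card_le_card_of_injOn (fun π => π * swap x y)
          · intro π hπ
            simp only [coe_filter, Set.mem_ofPred_eq, mem_univ, true_and, mem_insert] at hπ ⊢
            refine ⟨fun z hz => ?_, ?_⟩
            · have h1 : z ≠ x := fun h => hx (h ▸ hz)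
              have h2 : z ≠ y := fun h => hy (h ▸ hz)
              rw [Perm.mul_apply, swap_apply_of_ne_of_ne h1 h2]
              exact hπ z (Or.inr hz)
            · rw [Perm.mul_apply, swap_apply_right]
              exact hπ x (Or.inl rfl)
          · intro a _ b _ hab
            exact mul_right_cancel hab
      have h2 : ∑ y : α, (univ.filter fun π : Perm α => (∀ x ∈ X, π x ∈ W) ∧ π y ∈ W).card
          = f * W.card := by
        simp_rw [← filter_filter]
        have := Finset.sum_card_bipartiteAbove_eq_sum_card_bipartiteBelow
          (s := (univ : Finset α)) (t := univ.filter fun π : Perm α => ∀ x ∈ X, π x ∈ W)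
          (fun y π => π y ∈ W)
        simp only [bipartiteAbove, bipartiteBelow] at this
        rw [this]
        rw [hf, ← smul_eq_mul, ← Finset.sum_const]
        apply Finset.sum_congr rfl
        intro π _
        have : (univ.filter fun y => π y ∈ W) = W.map π.symm.toEmbedding := by
          ext y; simp
        rw [this, card_map]
      calc g * Fintype.card α = ∑ _y : α, g := by simp [mul_comm]
        _ ≤ _ := Finset.sum_le_sum fun y _ => h1 y
        _ = _ := h2
    rw [card_insert_of_notMem hx, pow_succ, pow_succ]
    calc g * (Fintype.card α ^ #X * Fintype.card α)
        = (g * Fintype.card α) * Fintype.card α ^ #X := by ring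
      _ ≤ (f * W.card) * Fintype.card α ^ #X := Nat.mul_le_mul_right _ key
      _ = (f * Fintype.card α ^ #X) * W.card := by ring
      _ ≤ (#W ^ #X * (Fintype.card α).factorial) * W.card := Nat.mul_le_mul_right _ ih
      _ = _ := by ring

theorem perm_union {α : Type*} [Fintype α] [DecidableEq α] [Nonempty α] (e : ℕ)
    (F : Finset (Finset α × Finset α))
    (hF : ∑ p ∈ F, ((p.2.card : ℝ) / Fintype.card α) ^ (p.1.card * e) < 1) :
    ∃ ω : Fin e → Perm α, ∀ p ∈ F, ∃ l, ∃ x ∈ p.1, ω l x ∉ p.2 := by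
  by_contra hcon
  push Not at hcon
  set m := Fintype.card α with hm
  have hmpos : (0:ℝ) < m := by exact_mod_cast Fintype.card_pos
  let bad : Finset α × Finset α → Finset (Fin e → Perm α) := fun p =>
    Fintype.piFinset fun _ => univ.filter fun π : Perm α => ∀ x ∈ p.1, π x ∈ p.2
  have hcov : (univ : Finset (Fin e → Perm α)) ⊆ F.biUnion bad := by
    intro ω _
    obtain ⟨p, hp, h⟩ := hcon ω
    simp only [mem_biUnion, bad, Fintype.mem_piFinset, mem_filter, mem_univ, true_and]
    exact ⟨p, hp, h⟩
  have h1 : ((m.factorial : ℝ)) ^ e ≤ ∑ p ∈ F, ((bad p).card : ℝ) := by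
    have := (card_le_card hcov).trans card_biUnion_le
    rw [card_univ, Fintype.card_fun, Fintype.card_perm, Fintype.card_fin] at this
    exact_mod_cast this
  have h2 : ∀ p ∈ F, ((bad p).card : ℝ) ≤
      ((p.2.card : ℝ) / m) ^ (p.1.card * e) * (m.factorial : ℝ) ^ e := by
    intro p _
    have := perm_count p.2 p.1
    simp only [bad, Fintype.card_piFinset_const]
    push_cast
    rw [pow_mul, ← mul_pow]
    apply pow_le_pow_left₀ (by positivity)
    rw [div_pow, div_mul_eq_mul_div, le_div_iff₀ (by positivity)]
    exact_mod_cast this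
  have h3 := h1.trans (Finset.sum_le_sum h2)
  rw [← Finset.sum_mul] at h3
  have : (0:ℝ) < (m.factorial : ℝ)^e := by positivity
  nlinarith

theorem choose_bound (m k : ℕ) (hk : 1 ≤ k) : ((m.choose k : ℕ) : ℝ) ≤ (3 * m / k) ^ k := by
  have h1 : ((m.choose k : ℕ) : ℝ) ≤ (m:ℝ) ^ k / k.factorial := Nat.choose_le_pow_div k m
  have h2 : (k:ℝ)^k / k.factorial ≤ Real.exp k := Real.pow_div_factorial_le_exp k (by positivity) k
  have h3 : Real.exp k ≤ 3 ^ k := by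
    rw [← Real.exp_one_pow]
    exact pow_le_pow_left₀ (Real.exp_pos _).le (by linarith [Real.exp_one_lt_d9]) _
  have hk0 : (0:ℝ) < k := by exact_mod_cast hk
  have h4 : (k:ℝ)^k ≤ 3^k * k.factorial := by
    rw [div_le_iff₀ (by positivity)] at h2
    nlinarith [show (0:ℝ) < k.factorial by positivity]
  refine h1.trans ?_
  rw [div_pow, mul_pow, div_le_div_iff₀ (by positivity) (by positivity)]
  nlinarith [show (0:ℝ) ≤ (m:ℝ)^k by positivity]

theorem term_bound (m k : ℕ) (hk : 1 ≤ k) (hkm : 4 * k ≤ m) :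
    ((m.choose k : ℕ) : ℝ) * ((m.choose (2 * k) : ℕ) : ℝ) * (((2 * k : ℕ) : ℝ) / m) ^ (k * 40)
      ≤ (1 / 4) ^ k := by
  have h1 := choose_bound m k hk
  have h2 := choose_bound m (2*k) (by omega)
  have hm : (0:ℝ) < m := by exact_mod_cast (by omega : 0 < m)
  have hk0 : (0:ℝ) < k := by exact_mod_cast hk
  have hx : (2 * k : ℝ) / m ≤ 1 / 2 := by
    rw [div_le_div_iff₀ hm (by norm_num)]
    have : (4 * k : ℝ) ≤ m := by exact_mod_cast hkm
    linarith
  calc _ ≤ (3 * m / k : ℝ) ^ k * (3 * m / (2 * k : ℕ)) ^ (2 * k)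
            * (((2 * k : ℕ) : ℝ) / m) ^ (k * 40) := by
          gcongr
    _ = ((3 * m / k : ℝ) * (3 * m / (2 * k)) ^ 2 * ((2 * k) / m) ^ 40) ^ k := by
          push_cast
          rw [mul_pow, mul_pow, ← pow_mul, ← pow_mul, mul_comm k 40]
    _ = (54 * ((2 * k : ℝ) / m) ^ 37) ^ k := by
          congr 1
          field_simp
          ring
    _ ≤ (54 * (1 / 2 : ℝ) ^ 37) ^ k := by gcongr
    _ ≤ (1/4) ^ k := by
          apply pow_le_pow_left₀ (by positivity); norm_num

theorem exists_expander (m : ℕ) (hm : 1 ≤ m) :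
    ∃ ω : Fin 40 → Perm (Fin m),
      (∀ X : Finset (Fin m), 4 * X.card ≤ m →
        2 * X.card ≤ (univ.biUnion fun l => X.image (ω l)).card) ∧
      (∀ A B : Finset (Fin m), m < 4 * A.card → m < 4 * B.card →
        ∃ l, ∃ x ∈ A, ω l x ∈ B) := by
  have : Nonempty (Fin m) := ⟨⟨0, hm⟩⟩
  let F1 : Finset (Finset (Fin m) × Finset (Fin m)) :=
    (Icc 1 (m/4)).biUnion fun k => (powersetCard k univ) ×ˢ (powersetCard (2*k) univ)
  let F2 : Finset (Finset (Fin m) × Finset (Fin m)) :=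
    univ.filter fun p => m < 4 * p.1.card ∧ 4 * p.2.card < 3 * m
  have hm0 : (0:ℝ) < m := by exact_mod_cast hm
  have hS1 : ∑ p ∈ F1, ((p.2.card : ℝ) / Fintype.card (Fin m)) ^ (p.1.card * 40) ≤ 1/3 := by
    have hdisj : ∀ k ∈ Icc 1 (m/4), ∀ k' ∈ Icc 1 (m/4), k ≠ k' →
      Disjoint ((powersetCard k (univ : Finset (Fin m))) ×ˢ (powersetCard (2*k) (univ : Finset (Fin m))))
        ((powersetCard k' univ) ×ˢ (powersetCard (2*k') univ)) := by
      intro k _ k' _ hne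
      rw [Finset.disjoint_left]
      rintro ⟨a, b⟩ h h'
      simp only [mem_product, mem_powersetCard] at h h'
      exact hne (h.1.2.symm.trans h'.1.2)
    rw [Finset.sum_biUnion hdisj]
    have : ∀ k ∈ Icc 1 (m/4), ∑ p ∈ (powersetCard k (univ : Finset (Fin m))) ×ˢ
        (powersetCard (2*k) (univ : Finset (Fin m))),
        ((p.2.card : ℝ) / Fintype.card (Fin m)) ^ (p.1.card * 40) ≤ (1/4:ℝ)^k := by
      intro k hk
      rw [mem_Icc] at hk
      refine le_trans (le_of_eq ?_) (term_bound m k hk.1 (by omega))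
      rw [Finset.sum_congr rfl (g := fun _ => (((2 * k : ℕ) : ℝ) / m) ^ (k * 40))]
      · rw [sum_const, card_product, card_powersetCard, card_powersetCard, card_univ,
          Fintype.card_fin, nsmul_eq_mul]
        push_cast; ring
      · rintro ⟨a, b⟩ h
        simp only [mem_product, mem_powersetCard] at h
        rw [h.1.2, h.2.2, Fintype.card_fin]
    refine (Finset.sum_le_sum this).trans ?_
    have hgeo : ∀ n : ℕ, ∑ k ∈ Icc 1 n, (1/4:ℝ)^k ≤ 1/3 - (1/3) * (1/4)^n := by
      intro n
      induction n with
      | zero => simp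
      | succ n ih =>
        rw [Finset.sum_Icc_succ_top (by omega), pow_succ]
        linarith
    have := hgeo (m/4)
    have h0 : (0:ℝ) ≤ (1/4:ℝ)^(m/4) := by positivity
    linarith
  have hS2 : ∑ p ∈ F2, ((p.2.card : ℝ) / Fintype.card (Fin m)) ^ (p.1.card * 40) ≤ 1/4 := by
    have : ∀ p ∈ F2, ((p.2.card : ℝ) / Fintype.card (Fin m)) ^ (p.1.card * 40)
        ≤ (3/4:ℝ)^(10 * m) := by
      intro p hp
      simp only [F2, mem_filter, mem_univ, true_and] at hp
      rw [Fintype.card_fin]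
      have h1 : (p.2.card : ℝ) / m ≤ 3/4 := by
        rw [div_le_div_iff₀ hm0 (by norm_num)]
        have : (4 * p.2.card : ℝ) < 3 * m := by exact_mod_cast hp.2
        linarith
      calc ((p.2.card : ℝ) / m) ^ (p.1.card * 40) ≤ (3/4) ^ (p.1.card * 40) := by gcongr
        _ ≤ _ := pow_le_pow_of_le_one (by norm_num) (by norm_num) (by omega)
    refine (Finset.sum_le_card_nsmul _ _ _ this).trans ?_
    rw [nsmul_eq_mul]
    have hc : (F2.card : ℝ) ≤ 4 ^ m := by
      have : F2.card ≤ 2^m * 2^m := by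
        refine (card_le_univ _).trans ?_
        simp
      have h4 : (4:ℝ)^m = 2^m * 2^m := by rw [← mul_pow]; norm_num
      rw [h4]; exact_mod_cast this
    calc (F2.card : ℝ) * (3/4)^(10*m) ≤ 4^m * (3/4)^(10*m) := by gcongr
      _ = (4 * (3/4)^10)^m := by rw [mul_pow, pow_mul]
      _ ≤ (1/4)^m := by apply pow_le_pow_left₀ (by positivity); norm_num
      _ ≤ (1/4)^1 := pow_le_pow_of_le_one (by norm_num) (by norm_num) hm
      _ = 1/4 := by norm_num
  obtain ⟨ω, hω⟩ := perm_union 40 (F1 ∪ F2) (by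
    have hu := Finset.sum_union_inter (s₁ := F1) (s₂ := F2)
      (f := fun p : Finset (Fin m) × Finset (Fin m) =>
        ((p.2.card : ℝ) / Fintype.card (Fin m)) ^ (p.1.card * 40))
    have h0 : 0 ≤ ∑ p ∈ F1 ∩ F2,
        ((p.2.card : ℝ) / Fintype.card (Fin m)) ^ (p.1.card * 40) :=
      Finset.sum_nonneg fun p _ => by positivity
    linarith)
  refine ⟨ω, ?_, ?_⟩
  · intro X hX
    by_contra hlt
    push Not at hlt
    have hXpos : 1 ≤ X.card := by omega
    obtain ⟨W, hW1, hW2⟩ := Finset.exists_superset_card_eq (s := univ.biUnion fun l => X.image (ω l))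
      (n := 2 * X.card) hlt.le (by rw [Fintype.card_fin]; omega)
    obtain ⟨l, x, hx, hxW⟩ := hω (X, W) (by
      simp only [F1, mem_union, mem_biUnion, mem_product, mem_powersetCard, mem_Icc]
      left
      exact ⟨X.card, ⟨hXpos, by omega⟩, ⟨subset_univ _, rfl⟩, subset_univ _, hW2⟩)
    apply hxW
    apply hW1
    simp only [mem_biUnion, mem_univ, true_and, mem_image]
    exact ⟨l, x, hx, rfl⟩
  · intro A B hA hB
    obtain ⟨l, x, hx, hxW⟩ := hω (A, Bᶜ) (by
      simp only [F2, mem_union, mem_filter, mem_univ, true_and]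
      right
      refine ⟨hA, ?_⟩
      rw [card_compl, Fintype.card_fin]
      omega)
    exact ⟨l, x, hx, by simpa using hxW⟩

end Expander
section HeapPerms
open Finset

/-- level `a` of the heap -/
def lvl (a : ℕ) : Finset ℕ := Finset.Ico (2 ^ a) (2 ^ (a + 1))

theorem mem_lvl {a x : ℕ} : x ∈ lvl a ↔ 2 ^ a ≤ x ∧ x < 2 ^ (a + 1) := by
  simp [lvl]

theorem log_of_mem_lvl {a x : ℕ} (h : x ∈ lvl a) : Nat.log 2 x = a := by
  rw [mem_lvl] at h
  exact Nat.log_eq_of_pow_le_of_lt_pow h.1 h.2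

/-- lift a level-wise function to the heap -/
def heapLift (f : ∀ a : ℕ, Fin (2 ^ a) → Fin (2 ^ a)) (x : ℕ) : ℕ :=
  2 ^ (Nat.log 2 x) + (f (Nat.log 2 x) ⟨(x - 2 ^ Nat.log 2 x) % 2 ^ Nat.log 2 x,
    Nat.mod_lt _ (by positivity)⟩ : ℕ)

theorem heapLift_add (f : ∀ a : ℕ, Fin (2 ^ a) → Fin (2 ^ a)) (a : ℕ) (i : Fin (2 ^ a)) :
    heapLift f (2 ^ a + i) = 2 ^ a + (f a i : ℕ) := by
  have h : Nat.log 2 (2 ^ a + i) = a := by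
    apply log_of_mem_lvl
    rw [mem_lvl, pow_succ]
    have := i.2
    omega
  unfold heapLift
  have key : ∀ b, b = a → 2 ^ b + (f b ⟨(2 ^ a + i - 2 ^ b) % 2 ^ b,
    Nat.mod_lt _ (by positivity)⟩ : ℕ) = 2 ^ a + (f a i : ℕ) := by
    rintro b rfl
    congr 3
    ext
    simp [Nat.mod_eq_of_lt i.2]
  exact key _ h

theorem exists_of_mem_lvl {a x : ℕ} (h : x ∈ lvl a) : ∃ i : Fin (2 ^ a), x = 2 ^ a + i := by
  rw [mem_lvl, pow_succ] at h
  exact ⟨⟨x - 2 ^ a, by omega⟩, by simp; omega⟩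

theorem add_mem_lvl {a : ℕ} (i : Fin (2 ^ a)) : 2 ^ a + (i : ℕ) ∈ lvl a := by
  rw [mem_lvl, pow_succ]
  have := i.2
  omega

/-- Level-wise expanding families of permutations. -/
structure HeapExp (π πi : ℕ → ℕ → ℕ) : Prop where
  inv : ∀ l a x, x ∈ lvl a → πi l (π l x) = x
  mem : ∀ l a x, x ∈ lvl a → π l x ∈ lvl a
  exp : ∀ a (X : Finset ℕ), X ⊆ lvl a → 4 * X.card ≤ 2 ^ a →
    2 * X.card ≤ ((range 40).biUnion fun l => X.image (π l)).card
  mix : ∀ a (A B : Finset ℕ), A ⊆ lvl a → B ⊆ lvl a → 2 ^ a < 4 * A.card → 2 ^ a < 4 * B.card →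
    ∃ l < 40, ∃ x ∈ A, π l x ∈ B

theorem exists_heapExp : ∃ π πi, HeapExp π πi := by
  choose ω hω1 hω2 using fun a : ℕ => exists_expander (2 ^ a) Nat.one_le_two_pow
  let c : ℕ → Fin 40 := fun l => ⟨l % 40, Nat.mod_lt _ (by norm_num)⟩
  let emb : ∀ a, Fin (2 ^ a) ↪ ℕ := fun a => ⟨fun i => 2 ^ a + i, fun i j h => by
    ext; simpa using h⟩
  have hval : ∀ a i, emb a i = 2 ^ a + (i : ℕ) := fun _ _ => rfl
  have hemb : ∀ a (X : Finset ℕ), X ⊆ lvl a → ∃ X' : Finset (Fin (2 ^ a)), X = X'.map (emb a) := by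
    intro a X hX
    refine ⟨univ.filter fun i => 2 ^ a + (i : ℕ) ∈ X, ?_⟩
    ext x
    simp only [mem_map, mem_filter, mem_univ, true_and, hval]
    constructor
    · intro hx
      obtain ⟨i, rfl⟩ := exists_of_mem_lvl (hX hx)
      exact ⟨i, hx, rfl⟩
    · rintro ⟨i, hi, rfl⟩
      exact hi
  refine ⟨fun l => heapLift fun a => ω a (c l), fun l => heapLift fun a => (ω a (c l)).symm, ?_⟩
  constructor
  · intro l a x hx
    obtain ⟨i, rfl⟩ := exists_of_mem_lvl hx
    simp only [heapLift_add, Equiv.symm_apply_apply]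
  · intro l a x hx
    obtain ⟨i, rfl⟩ := exists_of_mem_lvl hx
    simp only [heapLift_add]
    exact add_mem_lvl _
  · intro a X hX h4
    obtain ⟨X', rfl⟩ := hemb a X hX
    rw [card_map] at h4 ⊢
    refine (hω1 a X' h4).trans ?_
    rw [← card_map (emb a)]
    apply card_le_card
    intro y hy
    simp only [mem_map, mem_biUnion, mem_univ, true_and, mem_image, mem_range] at hy ⊢
    obtain ⟨_, ⟨l, i, hi, rfl⟩, rfl⟩ := hy
    refine ⟨l, l.2, emb a i, ⟨i, hi, rfl⟩, ?_⟩
    have : c l = l := by ext; simp [c]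
    simp only [hval, heapLift_add, this]
  · intro a A B hA hB h1 h2
    obtain ⟨A', rfl⟩ := hemb a A hA
    obtain ⟨B', rfl⟩ := hemb a B hB
    rw [card_map] at h1 h2
    obtain ⟨l, i, hi, hiB⟩ := hω2 a A' B' h1 h2
    refine ⟨l, l.2, emb a i, mem_map_of_mem _ hi, ?_⟩
    have : c l = l := by ext; simp [c]
    have hm := mem_map_of_mem (emb a) hiB
    simp only [hval, heapLift_add, this] at hm ⊢
    exact hm

/-- structured connection from input `x` to output `y` avoiding `QI`, `QO` -/
inductive Conn (π : ℕ → ℕ → ℕ) (QI QO : Finset ℕ) : ℕ → ℕ → ℕ → Prop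
  | direct (a x : ℕ) (l : ℕ) : l < 40 → x ∈ lvl a → x ∉ QI → π l x ∉ QO → Conn π QI QO a x (π l x)
  | step (a x y l l' : ℕ) : l < 40 → l' < 40 → x ∈ lvl (a + 1) → y ∈ lvl (a + 1) → x ∉ QI → y ∉ QO →
      Conn π QI QO a (π l x / 2) (π l' y / 2) → Conn π QI QO (a + 1) x y

theorem superconc {π πi : ℕ → ℕ → ℕ} (h : HeapExp π πi) (QI QO : Finset ℕ) (a : ℕ) :
    ∀ X Y : Finset ℕ, X ⊆ lvl a → Y ⊆ lvl a →
      (QI.filter (· < 2 ^ (a + 1))).card + (QO.filter (· < 2 ^ (a + 1))).card < X.card →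
      (QI.filter (· < 2 ^ (a + 1))).card + (QO.filter (· < 2 ^ (a + 1))).card < Y.card →
      ∃ x ∈ X, ∃ y ∈ Y, Conn π QI QO a x y := by
  induction a with
  | zero =>
    intro X Y hX hY h1 h2
    have hcard : (lvl 0).card = 1 := by simp [lvl]
    have hXc := card_le_card hX
    have hYc := card_le_card hY
    have hI : (QI.filter (· < 2 ^ (0 + 1))).card = 0 := by omega
    have hO : (QO.filter (· < 2 ^ (0 + 1))).card = 0 := by omega
    rw [card_eq_zero, filter_eq_empty_iff] at hI hO
    obtain ⟨l, hl, x, hx, hxy⟩ := h.mix 0 X Y hX hY (by simp; omega) (by simp; omega)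
    refine ⟨x, hx, π l x, hxy, Conn.direct 0 x l hl (hX hx) ?_ ?_⟩
    · intro hq; exact hI hq (mem_lvl.1 (hX hx)).2
    · intro hq; exact hO hq (mem_lvl.1 (hY hxy)).2
  | succ a ih =>
    intro X Y hX hY h1 h2
    have split : ∀ Q Z : Finset ℕ, Z ⊆ lvl (a + 1) →
        Z.card + (Q.filter (· < 2 ^ (a + 1))).card ≤
          (Z \ Q).card + (Q.filter (· < 2 ^ (a + 1 + 1))).card := by
      intro Q Z hZ
      have e1 : (Z \ Q).card + (Z ∩ Q).card = Z.card := card_sdiff_add_card_inter Z Q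
      have e2 : (Z ∩ Q).card + (Q.filter (· < 2 ^ (a + 1))).card ≤
          (Q.filter (· < 2 ^ (a + 1 + 1))).card := by
        rw [← card_union_of_disjoint]
        · apply card_le_card
          intro x hx
          simp only [mem_union, mem_inter, mem_filter] at hx ⊢
          have : 2 ^ (a+1) < 2 ^ (a+1+1) := Nat.pow_lt_pow_right (by norm_num) (by omega)
          rcases hx with hx | hx
          · exact ⟨hx.2, (mem_lvl.1 (hZ hx.1)).2⟩
          · exact ⟨hx.1, hx.2.trans this⟩
        · rw [Finset.disjoint_left]
          intro x hx hx'
          simp only [mem_inter, mem_filter] at hx hx'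
          have := (mem_lvl.1 (hZ hx.1)).1
          omega
      omega
    have sX := split QI X hX
    have sY := split QO Y hY
    have mono : ∀ Q : Finset ℕ, (Q.filter (· < 2 ^ (a + 1))).card ≤
        (Q.filter (· < 2 ^ (a + 1 + 1))).card := by
      intro Q
      apply card_le_card
      intro x hx
      simp only [mem_filter] at hx ⊢
      have : 2 ^ (a+1) < 2 ^ (a+1+1) := Nat.pow_lt_pow_right (by norm_num) (by omega)
      exact ⟨hx.1, by omega⟩
    have mI := mono QI
    have mO := mono QO
    set A := X \ QI with hA
    set B := Y \ QO with hB
    have hAl : A ⊆ lvl (a+1) := sdiff_subset.trans hX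
    have hBl : B ⊆ lvl (a+1) := sdiff_subset.trans hY
    by_cases hmix : 2 ^ (a+1) < 4 * A.card ∧ 2 ^ (a+1) < 4 * B.card
    · obtain ⟨l, hl, x, hx, hxy⟩ := h.mix (a+1) A B hAl hBl hmix.1 hmix.2
      rw [hA, mem_sdiff] at hx
      rw [hB, mem_sdiff] at hxy
      exact ⟨x, hx.1, _, hxy.1, Conn.direct _ x l hl (hX hx.1) hx.2 hxy.2⟩
    · have hc4 : 4 * min A.card B.card ≤ 2 ^ (a+1) := by
        rw [not_and_or] at hmix
        omega
      obtain ⟨A', hA', hA'c⟩ := exists_subset_card_eq (min_le_left A.card B.card)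
      obtain ⟨B', hB', hB'c⟩ := exists_subset_card_eq (min_le_right A.card B.card)
      have fold : ∀ Z ⊆ lvl (a+1), 4 * Z.card ≤ 2^(a+1) →
          ((range 40).biUnion fun l => Z.image (fun x => π l x / 2)) ⊆ lvl a ∧
          Z.card ≤ ((range 40).biUnion fun l => Z.image (fun x => π l x / 2)).card := by
        intro Z hZ hZc
        constructor
        · intro y hy
          simp only [mem_biUnion, mem_image] at hy
          obtain ⟨l, _, x, hx, rfl⟩ := hy
          have := mem_lvl.1 (h.mem l _ x (hZ hx))
          rw [pow_succ, pow_succ] at this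
          rw [mem_lvl, pow_succ]
          omega
        · have h1 := h.exp (a+1) Z hZ hZc
          set N := (range 40).biUnion fun l => Z.image (π l) with hN
          have h2 : N.card ≤ 2 * (N.image (· / 2)).card := by
            apply card_le_mul_card_image
            intro b _
            have : (N.filter fun x => x / 2 = b) ⊆ {2 * b, 2 * b + 1} := by
              intro x hx
              simp only [mem_filter, mem_insert, mem_singleton] at hx ⊢
              omega
            exact (card_le_card this).trans card_le_two
          have h3 : N.image (· / 2) =
              ((range 40).biUnion fun l => Z.image (fun x => π l x / 2)) := by
            rw [hN, biUnion_image]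
            simp only [image_image]
            rfl
          rw [h3] at h2
          omega
      obtain ⟨fA1, fA2⟩ := fold A' (hA'.trans hAl) (by omega)
      obtain ⟨fB1, fB2⟩ := fold B' (hB'.trans hBl) (by omega)
      obtain ⟨x1, hx1, y1, hy1, hc⟩ := ih _ _ fA1 fB1 (by omega) (by omega)
      simp only [mem_biUnion, mem_image, mem_range] at hx1 hy1
      obtain ⟨l, hl, x, hx, rfl⟩ := hx1
      obtain ⟨l', hl', y, hy, rfl⟩ := hy1
      have hxA := hA' hx
      have hyB := hB' hy
      rw [hA, mem_sdiff] at hxA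
      rw [hB, mem_sdiff] at hyB
      exact ⟨x, hxA.1, y, hyB.1, Conn.step a x y l l' hl hl' (hX hxA.1) (hY hyB.1) hxA.2 hyB.2 hc⟩

end HeapPerms
section Reach
namespace FinDigraph
open Set

/-- reachability by reversible moves with space bound `s` and time exactly `t` -/
inductive Reach (G : FinDigraph) (s : ℕ) : ℕ → Set G.V → Set G.V → Prop
  | refl (P : Set G.V) : P.ncard ≤ s → Reach G s 0 P P
  | step (t : ℕ) (P Q R : Set G.V) : Reach G s t P Q → G.RevMove Q R → R.ncard ≤ s →
      Reach G s (t + 1) P R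

theorem Reach.trans {G : FinDigraph} {s t t' : ℕ} {P Q R : Set G.V} (h1 : Reach G s t P Q)
    (h2 : Reach G s t' Q R) : Reach G s (t + t') P R := by
  induction h2 with
  | refl => exact h1
  | step t' Q R R' _ hm hc ih => exact Reach.step _ _ _ _ (ih h1) hm hc

theorem Reach.left_le {G : FinDigraph} {s t : ℕ} {P Q : Set G.V} (h1 : Reach G s t P Q) :
    P.ncard ≤ s := by
  induction h1 with
  | refl _ h => exact h
  | step _ _ _ _ _ _ _ ih => exact ih

theorem RevMove.symm' {G : FinDigraph} (hirr : ∀ v, ¬ G.Edge v v) {P Q : Set G.V}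
    (h : G.RevMove P Q) : G.RevMove Q P := by
  obtain ⟨v, hp, ⟨hv, rfl⟩ | ⟨hv, rfl⟩⟩ := h
  · refine ⟨v, hp.trans (subset_insert _ _), Or.inr ⟨mem_insert _ _, ?_⟩⟩
    simp [hv]
  · refine ⟨v, ?_, Or.inl ⟨by simp, ?_⟩⟩
    · intro u hu
      refine ⟨hp hu, ?_⟩
      rintro rfl
      exact hirr _ hu
    · simp [hv]

theorem Reach.symm' {G : FinDigraph} (hirr : ∀ v, ¬ G.Edge v v) {s t : ℕ} {P Q : Set G.V}
    (h : Reach G s t P Q) : Reach G s t Q P := by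
  induction h with
  | refl P h => exact Reach.refl P h
  | step t P Q R h1 hm hc ih =>
    have h0 : Q.ncard ≤ s := ih.left_le
    have := (Reach.step 0 R R Q (Reach.refl R hc) (hm.symm' hirr) h0).trans ih
    rwa [zero_add, add_comm] at this

theorem Reach.mono {G : FinDigraph} {s s' t : ℕ} (hs : s ≤ s') {P Q : Set G.V}
    (h : Reach G s t P Q) : Reach G s' t P Q := by
  induction h with
  | refl P h => exact Reach.refl P (h.trans hs)
  | step t P Q R h1 hm hc ih => exact Reach.step _ _ _ _ ih hm (hc.trans hs)

theorem Reach.exists_fun {G : FinDigraph} {s t : ℕ} {P Q : Set G.V} (h : Reach G s t P Q) :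
    ∃ f : ℕ → Set G.V, f 0 = P ∧ f t = Q ∧ (∀ i < t, G.RevMove (f i) (f (i + 1))) ∧
      ∀ i ≤ t, (f i).ncard ≤ s := by
  induction h with
  | refl P h => exact ⟨fun _ => P, rfl, rfl, by simp, by simpa using h⟩
  | step t P Q R h1 hm hc ih =>
    obtain ⟨f, f0, ft, fm, fc⟩ := ih
    refine ⟨fun i => if i ≤ t then f i else R, by simp [f0], by simp, ?_, ?_⟩
    · intro i hi
      rcases Nat.lt_succ_iff_lt_or_eq.1 hi with h | rfl
      · have h2 : i + 1 ≤ t := h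
        simp only [h.le, h2, if_true]
        exact fm i h
      · simp only [le_refl, if_true, Nat.not_succ_le_self, if_false, ft]
        exact hm
    · intro i _
      by_cases h : i ≤ t
      · simpa [h] using fc i h
      · simpa [h] using hc

/-- bounded reachability -/
def RB (G : FinDigraph) (s : ℕ) (τ : ℕ∞) (P Q : Set G.V) : Prop :=
  ∃ t : ℕ, (t : ℕ∞) ≤ τ ∧ Reach G s t P Q

theorem RB.trans {G : FinDigraph} {s : ℕ} {t t' : ℕ∞} {P Q R : Set G.V} (h1 : RB G s t P Q)
    (h2 : RB G s t' Q R) : RB G s (t + t') P R := by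
  obtain ⟨a, ha, h1⟩ := h1
  obtain ⟨b, hb, h2⟩ := h2
  exact ⟨a + b, by push_cast; exact add_le_add ha hb, h1.trans h2⟩

theorem RB.symm' {G : FinDigraph} (hirr : ∀ v, ¬ G.Edge v v) {s : ℕ} {t : ℕ∞} {P Q : Set G.V}
    (h : RB G s t P Q) : RB G s t Q P := by
  obtain ⟨a, ha, h⟩ := h
  exact ⟨a, ha, h.symm' hirr⟩

theorem RB.mono {G : FinDigraph} {s s' : ℕ} {t t' : ℕ∞} (hs : s ≤ s') (ht : t ≤ t')
    {P Q : Set G.V} (h : RB G s t P Q) : RB G s' t' P Q := by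
  obtain ⟨a, ha, h⟩ := h
  exact ⟨a, ha.trans ht, h.mono hs⟩

theorem RB.refl' {G : FinDigraph} {s : ℕ} {t : ℕ∞} {P : Set G.V} (h : P.ncard ≤ s) :
    RB G s t P P := ⟨0, by simp, Reach.refl P h⟩

theorem RB.place {G : FinDigraph} {s : ℕ} {t : ℕ∞} (ht : 1 ≤ t) {P : Set G.V} {v : G.V}
    (hv : G.pred v ⊆ P) (hs : P.ncard + 1 ≤ s) : RB G s t P (insert v P) := by
  by_cases h : v ∈ P
  · rw [insert_eq_of_mem h]; exact RB.refl' (by omega)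
  · refine ⟨1, by simpa using ht, ?_⟩
    refine Reach.step 0 P P _ (Reach.refl P (by omega)) ⟨v, hv, Or.inl ⟨h, rfl⟩⟩ ?_
    exact (ncard_insert_le _ _).trans hs

/-- From a one-way reachability from `∅` to a configuration containing the sink one gets a
reversible pebbling. -/
theorem RB.pebbling {G : FinDigraph} (hirr : ∀ v, ¬ G.Edge v v) {s : ℕ} {τ : ℕ∞} {Q : Set G.V}
    {z : G.V} (hz : z ∈ Q) (h : RB G s τ ∅ Q) :
    ∃ t P, G.IsRevPebbling z t P ∧ (t : ℕ∞) ≤ τ + τ ∧ G.space t P ≤ s := by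
  obtain ⟨t, ht, h⟩ := h
  obtain ⟨f, f0, ft, fm, fc⟩ := h.exists_fun
  obtain ⟨g, g0, gt, gm, gc⟩ := (h.symm' hirr).exists_fun
  refine ⟨t + t, fun i => if i ≤ t then f i else g (i - t), ⟨by simp [f0], ?_, ⟨t, by omega, ?_⟩, ?_⟩,
    by push_cast; exact add_le_add ht ht, ?_⟩
  · by_cases h0 : t = 0
    · subst h0; simp [f0]
    · have : ¬ (t + t ≤ t) := by omega
      simp [gt, h0]
  · simpa [ft] using hz
  · intro i hi
    by_cases h1 : i + 1 ≤ t
    · have : i ≤ t := by omega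
      simp only [h1, this, if_true]
      exact fm i (by omega)
    · by_cases h2 : i = t
      · subst h2
        simp only [le_refl, if_true, h1, if_false, Nat.add_sub_cancel_left]
        rw [ft, ← g0]
        exact gm 0 (by omega)
      · have h3 : ¬ i ≤ t := by omega
        have h4 : i + 1 - t = (i - t) + 1 := by omega
        simp only [h1, h3, if_false, h4]
        exact gm _ (by omega)
  · unfold space
    apply Finset.sup_le
    intro i hi
    rw [Finset.mem_range] at hi
    by_cases h1 : i ≤ t
    · simpa [h1] using fc i h1
    · simpa [h1] using gc (i - t) (by omega)

/-- the depth strategy -/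
theorem depth_reach (G : FinDigraph) (hirr : ∀ v, ¬ G.Edge v v) (good : G.V → Prop)
    (dep : G.V → ℕ) (hpred : ∀ v, good v → ∀ u ∈ G.pred v, good u ∧ dep u < dep v)
    (h2 : ∀ v, (G.pred v).ncard ≤ 2) (h : ℕ) :
    ∀ v, good v → dep v < h → ∀ P : Set G.V, RB G (P.ncard + 3 * h) ⊤ P (insert v P) := by
  induction h with
  | zero => intro v _ hv; omega
  | succ h ih =>
    intro v hg hv P
    by_cases hvP : v ∈ P
    · rw [insert_eq_of_mem hvP]; exact RB.refl' (by omega)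
    have multi : ∀ (P : Set G.V) (T : Set G.V), (∀ u ∈ T, good u ∧ dep u < h) →
        RB G (P.ncard + T.ncard + 3 * h) ⊤ P (P ∪ T) := by
      intro P T
      induction T, (toFinite T) using Set.Finite.induction_on with
      | empty => intro _; simp only [union_empty]; exact RB.refl' (by omega)
      | @insert u T hu hT ih2 =>
        intro hT'
        have e1 := ih2 (fun w hw => hT' w (mem_insert_of_mem _ hw))
        have e2 := ih u (hT' u (mem_insert _ _)).1 (hT' u (mem_insert _ _)).2 (P ∪ T)
        rw [ncard_insert_of_notMem hu hT, union_insert]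
        have hc := ncard_union_le P T
        exact (e1.mono (by omega) le_rfl).trans (e2.mono (by omega) le_rfl)
    have hT : ∀ u ∈ G.pred v, good u ∧ dep u < h := fun u hu =>
      ⟨(hpred v hg u hu).1, by have := (hpred v hg u hu).2; omega⟩
    have e1 := multi P (G.pred v) hT
    have e2 := multi (insert v P) (G.pred v) hT
    have e3 : RB G (P.ncard + 3 * (h + 1)) ⊤ (P ∪ G.pred v) (insert v (P ∪ G.pred v)) := by
      apply RB.place (by simp) subset_union_right
      have := ncard_union_le P (G.pred v)
      have := h2 v
      omega
    have hc := ncard_insert_le v P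
    have := h2 v
    rw [insert_union] at e2
    have e4 := (e2.symm' hirr).mono (s' := P.ncard + 3 * (h + 1)) (by omega) le_rfl
    exact (((e1.mono (by omega) le_rfl).trans e3).trans e4).mono le_rfl le_top

/-- the chain strategy -/
theorem chain_reach (G : FinDigraph) (hirr : ∀ v, ¬ G.Edge v v) (B : ℕ → Set G.V)
    (β μ : ℕ) (τ : ℕ∞) (b : ℕ) (hb : 1 ≤ b) (hβ : ∀ i, (B i).ncard ≤ β)
    (hstep : ∀ i, ∀ P : Set G.V, B i ⊆ P → RB G (P.ncard + μ) τ P (P ∪ B (i + 1))) (k : ℕ) :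
    ∀ i, ∀ P : Set G.V, B i ⊆ P →
      RB G (P.ncard + μ + k * (b * β)) (((2 * b) ^ k : ℕ) * τ) P (P ∪ B (i + b ^ k)) := by
  induction k with
  | zero =>
    intro i P hP
    simpa using hstep i P hP
  | succ k ih =>
    intro i P hP
    set L := b ^ k with hL
    set T : ℕ∞ := ((2 * b) ^ k : ℕ) * τ with hT
    let U : ℕ → Set G.V := fun j => ⋃ j' ∈ Finset.Icc 1 j, B (i + j' * L)
    have hU : ∀ j, U (j + 1) = U j ∪ B (i + (j + 1) * L) := by
      intro j
      ext x
      simp only [U, mem_iUnion, Finset.mem_Icc, mem_union, exists_prop]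
      constructor
      · rintro ⟨j', hj', hx⟩
        by_cases h : j' = j + 1
        · subst h; exact Or.inr hx
        · exact Or.inl ⟨j', by omega, hx⟩
      · rintro (⟨j', hj', hx⟩ | hx)
        · exact ⟨j', by omega, hx⟩
        · exact ⟨j + 1, by omega, hx⟩
    have hU0 : U 0 = ∅ := by
      ext x
      simp only [U, mem_iUnion, Finset.mem_Icc, exists_prop, mem_empty_iff_false, iff_false]
      rintro ⟨j', hj', _⟩
      omega
    have hUc : ∀ j, (U j).ncard ≤ j * β := by
      intro j
      induction j with
      | zero => simp [hU0]
      | succ j ihj =>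
        rw [hU]
        have := ncard_union_le (U j) (B (i + (j + 1) * L))
        have := hβ (i + (j + 1) * L)
        have : (j + 1) * β = j * β + β := by ring
        omega
    have fwd : ∀ j, ∀ P : Set G.V, B i ⊆ P →
        RB G (P.ncard + j * β + μ + k * (b * β)) (j * T) P (P ∪ U j) := by
      intro j
      induction j with
      | zero => intro P _; rw [hU0, union_empty]; exact RB.refl' (by omega)
      | succ j ihj =>
        intro P hP
        have e1 := ihj P hP
        have e2 := ih (i + j * L) (P ∪ U j) (by
          rcases Nat.eq_zero_or_pos j with rfl | hj
          · simpa using hP.trans subset_union_left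
          · refine subset_union_of_subset_right ?_ _
            intro x hx
            simp only [U, mem_iUnion, Finset.mem_Icc, exists_prop]
            exact ⟨j, by omega, hx⟩)
        have hc := ncard_union_le P (U j)
        have hc' := hUc j
        have e3 : (j + 1) * β = j * β + β := by ring
        rw [hU, ← union_assoc, show i + (j + 1) * L = i + j * L + L by ring]
        refine ((e1.mono ?_ le_rfl).trans (e2.mono ?_ le_rfl)).mono le_rfl ?_
        · omega
        · omega
        · push_cast
          rw [add_mul, one_mul]
    have f1 := fwd b P hP
    obtain ⟨b', rfl⟩ : ∃ b', b = b' + 1 := ⟨b - 1, by omega⟩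
    have f2 := (fwd b' (P ∪ B (i + (b' + 1) * L)) (hP.trans subset_union_left)).symm' hirr
    have hc := ncard_union_le P (B (i + (b' + 1) * L))
    have hc' := hβ (i + (b' + 1) * L)
    have e3 : (b' + 1) * β = b' * β + β := by ring
    have e4 : (k + 1) * ((b' + 1) * β) = k * ((b' + 1) * β) + (b' * β + β) := by ring
    rw [hU, union_comm (U b'), ← union_assoc] at f1
    have e5 : (b' + 1) ^ (k + 1) = (b' + 1) * L := by rw [hL]; ring
    rw [e5]
    refine ((f1.mono ?_ le_rfl).trans (f2.mono ?_ le_rfl)).mono le_rfl ?_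
    · omega
    · omega
    · rw [← add_mul, pow_succ, Nat.cast_mul, mul_comm (((2 * (b' + 1)) ^ k : ℕ) : ℕ∞), mul_assoc, ← hT]
      gcongr
      have : (b' + 1) + b' ≤ 2 * (b' + 1) := by omega
      exact_mod_cast this

end FinDigraph
end Reach
section FinalGraph
open FinDigraph

/-- edges (on natural numbers) of the final graph -/
def FE (pr : ℕ → ℕ → ℕ) (D : ℕ → ℕ) (B : ℕ) (u w : ℕ) : Prop :=
  (w % 81 ≠ 0 ∧ u + 1 = w) ∨
  (w % 81 < 80 ∧ u % 81 = 79 ∧ pr (w / 81) (w % 81) = u / 81 ∧ u / 81 < w / 81 ∧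
    D (u / 81) < D (w / 81) ∧ w / 81 / B ≤ u / 81 / B + 1) ∨
  (w % 81 = 80 ∧ u + 81 = w)

/-- the final graph -/
def FG (pr : ℕ → ℕ → ℕ) (D : ℕ → ℕ) (B r : ℕ) : FinDigraph where
  V := Fin (r * B * 81)
  Edge u w := FE pr D B u.1 w.1

variable {pr : ℕ → ℕ → ℕ} {D : ℕ → ℕ} {B r : ℕ}

theorem FE.lt {u w : ℕ} (h : FE pr D B u w) : u < w := by
  rcases h with h | h | h <;> omega

theorem FE.block (hB : 1 ≤ B) {u w : ℕ} (h : FE pr D B u w) : w / 81 / B ≤ u / 81 / B + 1 := by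
  rcases h with h | h | h
  · have : u / 81 = w / 81 := by omega
    rw [this]; omega
  · exact h.2.2.2.2.2
  · have : w / 81 = u / 81 + 1 := by omega
    rw [this]
    calc (u / 81 + 1) / B ≤ (u / 81 + B) / B := Nat.div_le_div_right (by omega)
      _ = _ := Nat.add_div_right _ (by omega)

theorem FE.dep {u w : ℕ} (h : FE pr D B u w) (hw : w % 81 < 80) :
    u % 81 < 80 ∧ D (u / 81) * 81 + u % 81 < D (w / 81) * 81 + w % 81 := by
  rcases h with h | h | h
  · have : u / 81 = w / 81 := by omega
    rw [this]; omega
  · omega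
  · omega

theorem FG_irr (v : (FG pr D B r).V) : ¬ (FG pr D B r).Edge v v := fun h => absurd (FE.lt h) (lt_irrefl _)

theorem FG_acyclic : (FG pr D B r).Acyclic := by
  intro v hv
  have key : ∀ u w : (FG pr D B r).V, Relation.TransGen (FG pr D B r).Edge u w →
      (show Fin (r * B * 81) from u).1 < (show Fin (r * B * 81) from w).1 := by
    intro u w h
    induction h with
    | single h => exact FE.lt h
    | tail _ h ih => exact ih.trans (FE.lt h)
  exact absurd (key v v hv) (lt_irrefl _)

/-- every vertex other than the last has a successor -/
theorem FE_succ (u N : ℕ) (hu : u < N * 81) (hne : u ≠ N * 81 - 1) :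
    ∃ w, w < N * 81 ∧ FE pr D B u w := by
  by_cases h : u % 81 = 80
  · exact ⟨u + 81, by omega, Or.inr (Or.inr ⟨by omega, rfl⟩)⟩
  · exact ⟨u + 1, by omega, Or.inl ⟨by omega, rfl⟩⟩

/-- the sink -/
def FGsink (pr : ℕ → ℕ → ℕ) (D : ℕ → ℕ) (B r : ℕ) (h : 0 < r * B) : (FG pr D B r).V :=
  (⟨r * B * 81 - 1, by omega⟩ : Fin (r * B * 81))

theorem FG_sink (h : 0 < r * B) : (FG pr D B r).UniqueSink (FGsink pr D B r h) := by
  constructor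
  · intro u hu
    have h1 : r * B * 81 - 1 < (show Fin (r * B * 81) from u).1 := FE.lt hu
    have := (show Fin (r * B * 81) from u).2
    omega
  · intro v hv
    by_contra hne
    obtain ⟨w, hw, he⟩ := FE_succ (pr := pr) (D := D) (B := B) (show Fin (r * B * 81) from v).1 (r * B)
      (show Fin (r * B * 81) from v).2 (fun h => hne (Fin.ext h))
    exact hv (⟨w, hw⟩ : Fin (r * B * 81)) he

theorem FG_model (hpos : 0 < r * B) : ∃ (vl : (FG pr D B r).V → ℕ)
    (mk : ∀ x, x < r * B * 81 → (FG pr D B r).V), (∀ v, vl v < r * B * 81) ∧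
    (∀ u v, vl u = vl v → u = v) ∧ (∀ x h, vl (mk x h) = x) ∧
    (∀ u w, (FG pr D B r).Edge u w ↔ FE pr D B (vl u) (vl w)) ∧
    vl (FGsink pr D B r hpos) = r * B * 81 - 1 :=
  ⟨fun v : Fin (r * B * 81) => v.1, fun x h => (⟨x, h⟩ : Fin (r * B * 81)),
    fun v : Fin (r * B * 81) => v.2, fun _ _ h => Fin.ext h,
    fun _ _ => rfl, fun _ _ => Iff.rfl, rfl⟩

theorem FG_indeg (v : (FG pr D B r).V) : ((FG pr D B r).pred v).ncard ≤ 2 := by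
  classical
  have hpos : 0 < r * B := by
    have : 0 < r * B * 81 := lt_of_le_of_lt (Nat.zero_le _) (show Fin (r * B * 81) from v).2
    omega
  obtain ⟨vl, mk, vlt, vinj, hmk, hE, hsk⟩ := FG_model (pr := pr) (D := D) hpos
  obtain ⟨w, hw⟩ : ∃ w, w = vl v := ⟨_, rfl⟩
  let T : Finset ℕ := {w - 1, if w % 81 < 80 then pr (w / 81) (w % 81) * 81 + 79 else w - 81}
  have h1 : ((FG pr D B r).pred v).ncard ≤ (T : Set ℕ).ncard := by
    apply Set.ncard_le_ncard_of_injOn vl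
    · intro u hu
      have hu : FE pr D B (vl u) w := by rw [hw]; exact (hE _ _).1 hu
      simp only [T, Finset.coe_insert, Finset.coe_singleton, Set.mem_insert_iff,
        Set.mem_singleton_iff]
      rcases hu with h | h | h
      · left; omega
      · right; rw [if_pos h.1]; omega
      · right; rw [if_neg (by omega)]; omega
    · intro a _ b _ hab
      exact vinj _ _ hab
  rw [Set.ncard_coe_finset] at h1
  exact h1.trans Finset.card_le_two

theorem FG_card : Fintype.card (FG pr D B r).V = r * B * 81 := by
  show Fintype.card (Fin (r * B * 81)) = _
  simp

theorem FG_price (hpos : 0 < r * B) (H k : ℕ) (hD : ∀ v < r * B, D v < H) (hk : r * B ≤ 2 ^ k) :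
    ∃ t P, (FG pr D B r).IsRevPebbling (FGsink pr D B r hpos) t P ∧
      (FG pr D B r).space t P ≤ 3 * (81 * H) + 2 + 2 * k := by
  obtain ⟨vl, mk, vlt, vinj, hmk, hE, hsk⟩ := FG_model (pr := pr) (D := D) hpos
  have hdep := depth_reach (FG pr D B r) FG_irr (fun v => vl v % 81 < 80)
    (fun v => D (vl v / 81) * 81 + vl v % 81)
    (fun v hv u hu => FE.dep ((hE _ _).1 hu) hv) FG_indeg (81 * H)
  let C : ℕ → Set (FG pr D B r).V := fun i => {w | vl w % 81 = 80 ∧ vl w / 81 + 1 = min i (r * B)}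
  have hC1 : ∀ i, (C i).ncard ≤ 1 := by
    intro i
    rw [Set.ncard_le_one (Set.toFinite _)]
    intro a ha b hb
    apply vinj
    have ha : vl a % 81 = 80 ∧ vl a / 81 + 1 = min i (r * B) := ha
    have hb : vl b % 81 = 80 ∧ vl b / 81 + 1 = min i (r * B) := hb
    omega
  have hstep : ∀ i, ∀ P : Set (FG pr D B r).V, C i ⊆ P → RB (FG pr D B r) (P.ncard + (3 * (81 * H) + 2)) ⊤ P (P ∪ C (i + 1)) := by
    intro i P hP
    by_cases hi : r * B ≤ i
    · have : C (i + 1) = C i := by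
        simp only [C]
        rw [min_eq_right hi, min_eq_right (by omega)]
      rw [this, Set.union_eq_left.2 hP]
      exact RB.refl' (by omega)
    push Not at hi
    set w := mk (81 * i + 80) (by omega) with hw
    set u := mk (81 * i + 79) (by omega) with hu
    have hCi : C (i + 1) = {w} := by
      ext x
      simp only [C, Set.mem_ofPred_eq, Set.mem_singleton_iff]
      constructor
      · intro hx
        apply vinj
        rw [hw, hmk]
        omega
      · rintro rfl
        rw [hw, hmk]
        omega
    rw [hCi, Set.union_singleton]
    have hug : vl u % 81 < 80 := by rw [hu, hmk]; omega
    have hud : D (vl u / 81) * 81 + vl u % 81 < 81 * H := by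
      have h1 : vl u / 81 = i := by rw [hu, hmk]; omega
      have h2 := hD i hi
      rw [h1]; omega
    have e1 := hdep u hug hud P
    have e2 := hdep u hug hud (insert w P)
    have e3 : RB (FG pr D B r) (P.ncard + (3 * (81 * H) + 2)) ⊤ (insert u P) (insert w (insert u P)) := by
      apply RB.place (by simp)
      · intro x hx
        have hx : FE pr D B (vl x) (vl w) := (hE _ _).1 hx
        rw [hw, hmk] at hx
        rcases hx with h | h | h
        · left; apply vinj; rw [hu, hmk]; omega
        · omega
        · right; apply hP; show vl x % 81 = 80 ∧ vl x / 81 + 1 = min i (r * B); omega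
      · have := Set.ncard_insert_le u P
        omega
    rw [Set.insert_comm] at e3
    have hc := Set.ncard_insert_le w P
    exact (((e1.mono (by omega) le_rfl).trans e3).trans
      ((e2.symm' FG_irr).mono (by omega) le_rfl)).mono le_rfl le_top
  have hch := chain_reach (FG pr D B r) FG_irr C 1 (3 * (81 * H) + 2) ⊤ 2 (by norm_num) hC1 hstep k 0 ∅ (by
    intro x hx
    have hx : vl x % 81 = 80 ∧ vl x / 81 + 1 = min 0 (r * B) := hx
    omega)
  obtain ⟨t, P, hp, _, hs⟩ := RB.pebbling FG_irr (z := FGsink pr D B r hpos) (by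
    right
    show vl _ % 81 = 80 ∧ vl _ / 81 + 1 = min (0 + 2 ^ k) (r * B)
    rw [hsk]
    rw [min_eq_right (by omega)]
    omega) hch
  refine ⟨t, P, hp, hs.trans ?_⟩
  rw [Set.ncard_empty]
  omega

theorem FG_linear (hr : 0 < r) (hB : 0 < B) (hpos : 0 < r * B) (b k : ℕ) (hb : 1 ≤ b) (hk : r ≤ b ^ k) :
    ∃ t P, (FG pr D B r).IsRevPebbling (FGsink pr D B r hpos) t P ∧
      t ≤ 2 * ((2 * b) ^ k * (81 * B)) ∧
      (FG pr D B r).space t P ≤ 81 * B + k * (b * (81 * B)) := by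
  obtain ⟨vl, mk, vlt, vinj, hmk, hE, hsk⟩ := FG_model (pr := pr) (D := D) hpos
  let C : ℕ → Set (FG pr D B r).V := fun i => {w | vl w / 81 / B + 1 = min i r}
  have hblk : ∀ x i, x / 81 / B = i ↔ i * (81 * B) ≤ x ∧ x < i * (81 * B) + 81 * B := by
    intro x i
    have hB' : 0 < 81 * B := by omega
    rw [Nat.div_div_eq_div_mul]
    constructor
    · rintro rfl
      have h1 := Nat.div_add_mod x (81 * B)
      have h2 := Nat.mod_lt x hB'
      rw [mul_comm] at h1
      omega
    · rintro ⟨h1, h2⟩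
      apply le_antisymm
      · rw [← Nat.lt_succ_iff, Nat.div_lt_iff_lt_mul hB', Nat.succ_mul]
        exact h2
      · rwa [Nat.le_div_iff_mul_le hB']
  have hival : ∀ a c, ({w : (FG pr D B r).V | a ≤ vl w ∧ vl w < a + c} : Set (FG pr D B r).V).ncard ≤ c := by
    intro a c
    have h1 : ({w : (FG pr D B r).V | a ≤ vl w ∧ vl w < a + c} : Set (FG pr D B r).V).ncard ≤
        ((Finset.Ico a (a + c) : Finset ℕ) : Set ℕ).ncard := by
      apply Set.ncard_le_ncard_of_injOn vl
      · intro w hw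
        simpa using hw
      · intro a _ b _ hab
        exact vinj _ _ hab
    rw [Set.ncard_coe_finset] at h1
    simpa using h1
  have hC1 : ∀ i, (C i).ncard ≤ 81 * B := by
    intro i
    refine le_trans (Set.ncard_le_ncard ?_ (Set.toFinite _)) (hival ((min i r - 1) * (81 * B)) (81 * B))
    intro w hw
    have hw : vl w / 81 / B + 1 = min i r := hw
    exact (hblk _ _).1 (Nat.eq_sub_of_add_eq hw)
  have hstep : ∀ i, ∀ P : Set (FG pr D B r).V, C i ⊆ P →
      RB (FG pr D B r) (P.ncard + 81 * B) ((81 * B : ℕ) : ℕ∞) P (P ∪ C (i + 1)) := by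
    intro i P hP
    by_cases hi : r ≤ i
    · have : C (i + 1) = C i := by
        simp only [C]
        rw [min_eq_right hi, min_eq_right (by omega)]
      rw [this, Set.union_eq_left.2 hP]
      exact RB.refl' (by omega)
    push Not at hi
    have sweep : ∀ j, j ≤ 81 * B → RB (FG pr D B r) (P.ncard + j) ((j : ℕ) : ℕ∞) P
        (P ∪ {w : (FG pr D B r).V | i * (81 * B) ≤ vl w ∧ vl w < i * (81 * B) + j}) := by
      intro j
      induction j with
      | zero =>
        intro _
        have : {w : (FG pr D B r).V | i * (81 * B) ≤ vl w ∧ vl w < i * (81 * B) + 0} = ∅ := by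
          ext x
          simp only [Set.mem_ofPred_eq, Set.mem_empty_iff_false, iff_false]
          omega
        rw [this, Set.union_empty]
        exact RB.refl' (by omega)
      | succ j ihj =>
        intro hj
        have e1 := ihj (by omega)
        have hlt : i * (81 * B) + j < r * B * 81 := by
          have : (i + 1) * (81 * B) ≤ r * (81 * B) := Nat.mul_le_mul_right _ hi
          have h2 : r * B * 81 = r * (81 * B) := by ring
          rw [add_mul] at this
          omega
        set w := mk (i * (81 * B) + j) hlt with hw
        have hset : P ∪ {w : (FG pr D B r).V | i * (81 * B) ≤ vl w ∧ vl w < i * (81 * B) + (j + 1)} =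
            insert w (P ∪ {w : (FG pr D B r).V | i * (81 * B) ≤ vl w ∧ vl w < i * (81 * B) + j}) := by
          ext x
          simp only [Set.mem_union, Set.mem_ofPred_eq, Set.mem_insert_iff]
          have hxw : x = w ↔ vl x = i * (81 * B) + j :=
            ⟨fun h => by rw [h, hw, hmk], fun h => vinj _ _ (by rw [h, hw, hmk])⟩
          rw [hxw]
          constructor
          · rintro (h | h)
            · exact Or.inr (Or.inl h)
            · by_cases h' : vl x = i * (81 * B) + j
              · exact Or.inl h'
              · exact Or.inr (Or.inr (by omega))
          · rintro (h | h | h)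
            · exact Or.inr (by omega)
            · exact Or.inl h
            · exact Or.inr (by omega)
        rw [hset]
        have e2 : RB (FG pr D B r) (P.ncard + (j + 1)) 1
            (P ∪ {w : (FG pr D B r).V | i * (81 * B) ≤ vl w ∧ vl w < i * (81 * B) + j})
            (insert w (P ∪ {w : (FG pr D B r).V | i * (81 * B) ≤ vl w ∧ vl w < i * (81 * B) + j})) := by
          apply RB.place le_rfl
          · intro x hx
            have hx : FE pr D B (vl x) (vl w) := (hE _ _).1 hx
            have h1 := hx.lt
            have h2 := hx.block hB
            have h3 : vl w / 81 / B = i := (hblk _ _).2 (by rw [hw, hmk]; omega)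
            rw [h3] at h2
            by_cases h4 : i * (81 * B) ≤ vl x
            · right
              refine ⟨h4, ?_⟩
              rw [hw, hmk] at h1
              exact h1
            · left
              apply hP
              show vl x / 81 / B + 1 = min i r
              have h5 : vl x / 81 / B < i := by
                rw [Nat.div_div_eq_div_mul, Nat.div_lt_iff_lt_mul (by omega)]
                omega
              omega
          · have h1 := Set.ncard_union_le P {w : (FG pr D B r).V | i * (81 * B) ≤ vl w ∧ vl w < i * (81 * B) + j}
            have h2 := hival (i * (81 * B)) j
            omega
        refine ((e1.mono (by omega) le_rfl).trans e2).mono le_rfl ?_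
        push_cast
        exact le_rfl
    have := sweep (81 * B) le_rfl
    have hCeq : C (i + 1) = {w : (FG pr D B r).V | i * (81 * B) ≤ vl w ∧ vl w < i * (81 * B) + 81 * B} := by
      ext x
      simp only [C, Set.mem_ofPred_eq]
      rw [← hblk]
      omega
    rw [hCeq]
    exact this
  have hch := chain_reach (FG pr D B r) FG_irr C (81 * B) (81 * B) ((81 * B : ℕ) : ℕ∞) b hb hC1 hstep k 0 ∅ (by
    intro x hx
    have hx : vl x / 81 / B + 1 = min 0 r := hx
    rw [Nat.zero_min] at hx
    exact absurd hx (Nat.succ_ne_zero _))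
  obtain ⟨t, P, hp, ht, hs⟩ := RB.pebbling FG_irr (z := FGsink pr D B r hpos) (by
    right
    show vl _ / 81 / B + 1 = min (0 + b ^ k) r
    rw [hsk]
    rw [min_eq_right (by omega)]
    have h2 : r * B * 81 = (r - 1) * (81 * B) + 81 * B := by
      obtain ⟨r', rfl⟩ : ∃ r', r = r' + 1 := ⟨r - 1, by omega⟩
      simp; ring
    have : (r * B * 81 - 1) / 81 / B = r - 1 := (hblk _ _).2 (by omega)
    rw [this]; omega) hch
  refine ⟨t, P, hp, ?_, hs.trans ?_⟩
  · have : (t : ℕ∞) ≤ ((2 * ((2 * b) ^ k * (81 * B)) : ℕ) : ℕ∞) := by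
      refine ht.trans (le_of_eq ?_)
      push_cast
      ring
    exact_mod_cast this
  · rw [Set.ncard_empty]
    omega

end FinalGraph
section Base

/-- input vertices of block `k` -/
def inId (M k x : ℕ) : ℕ := 4 * M * k + (2 * M - 1 - x)
/-- output vertices of block `k` -/
def outId (M k x : ℕ) : ℕ := 4 * M * k + (2 * M + x)

/-- predecessors in the base graph -/
def prC (π πi : ℕ → ℕ → ℕ) (M v l : ℕ) : ℕ :=
  if v % (4 * M) < 2 * M then
    if 2 * M - 1 - v % (4 * M) < M then
      if l < 40 then inId M (v / (4 * M)) (πi l (2 * (2 * M - 1 - v % (4 * M))))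
      else inId M (v / (4 * M)) (πi (l - 40) (2 * (2 * M - 1 - v % (4 * M)) + 1))
    else outId M (v / (4 * M) - 1) (2 * M - 1 - v % (4 * M))
  else
    if l < 40 then outId M (v / (4 * M)) (π l (v % (4 * M) - 2 * M) / 2)
    else inId M (v / (4 * M)) (πi (l - 40) (v % (4 * M) - 2 * M))

/-- depth in the base graph -/
def DC (J M v : ℕ) : ℕ :=
  v / (4 * M) * (2 * J + 4) + (if v % (4 * M) < 2 * M then J + 1 - Nat.log 2 (2 * M - 1 - v % (4 * M))
    else J + 2 + Nat.log 2 (v % (4 * M) - 2 * M))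

/-- edges of the base graph -/
def BE (pr : ℕ → ℕ → ℕ) (D : ℕ → ℕ) (B u v : ℕ) : Prop :=
  ∃ l < 80, pr v l = u ∧ u < v ∧ D u < D v ∧ v / B ≤ u / B + 1

theorem dec_div {M k q : ℕ} (hq : q < 4 * M) : (4 * M * k + q) / (4 * M) = k := by
  rw [Nat.mul_add_div (by omega), Nat.div_eq_of_lt hq, add_zero]

theorem dec_mod {M k q : ℕ} (hq : q < 4 * M) : (4 * M * k + q) % (4 * M) = q := by
  rw [Nat.mul_add_mod, Nat.mod_eq_of_lt hq]

theorem inId_div {M k x : ℕ} (hM : 0 < M) : inId M k x / (4 * M) = k := dec_div (by omega)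
theorem inId_mod {M k x : ℕ} (hM : 0 < M) : inId M k x % (4 * M) = 2 * M - 1 - x := dec_mod (by omega)
theorem outId_div {M k x : ℕ} (hx : x < 2 * M) : outId M k x / (4 * M) = k := dec_div (by omega)
theorem outId_mod {M k x : ℕ} (hx : x < 2 * M) : outId M k x % (4 * M) = 2 * M + x := dec_mod (by omega)

theorem DC_in {J M k x : ℕ} (hx : x < 2 * M) :
    DC J M (inId M k x) = k * (2 * J + 4) + (J + 1 - Nat.log 2 x) := by
  unfold DC
  rw [inId_div (by omega), inId_mod (by omega), if_pos (by omega),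
    show 2 * M - 1 - (2 * M - 1 - x) = x by omega]

theorem DC_out {J M k x : ℕ} (hx : x < 2 * M) :
    DC J M (outId M k x) = k * (2 * J + 4) + (J + 2 + Nat.log 2 x) := by
  unfold DC
  rw [outId_div hx, outId_mod hx, if_neg (by omega), show 2 * M + x - 2 * M = x by omega]

theorem lvl_log {a x : ℕ} (h : x ∈ lvl a) : Nat.log 2 x = a := by
  rw [mem_lvl] at h
  exact Nat.log_eq_of_pow_le_of_lt_pow h.1 h.2

theorem DC_lt {J M r v : ℕ} (hM : M = 2 ^ J) (hv : v < r * (4 * M)) :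
    DC J M v < r * (2 * J + 4) := by
  have hM0 : 0 < M := by rw [hM]; positivity
  have hk : v / (4 * M) < r := by rwa [Nat.div_lt_iff_lt_mul (by omega)]
  have h1 : (v / (4 * M) + 1) * (2 * J + 4) ≤ r * (2 * J + 4) := Nat.mul_le_mul_right _ hk
  have h2 : (if v % (4 * M) < 2 * M then J + 1 - Nat.log 2 (2 * M - 1 - v % (4 * M))
    else J + 2 + Nat.log 2 (v % (4 * M) - 2 * M)) < 2 * J + 4 := by
    split_ifs with h
    · omega
    · have h3 : v % (4 * M) < 4 * M := Nat.mod_lt _ (by omega)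
      have : Nat.log 2 (v % (4 * M) - 2 * M) < J + 1 := by
        apply Nat.log_lt_of_lt_pow' (by omega)
        rw [pow_succ, ← hM]; omega
      omega
  unfold DC
  rw [add_mul, one_mul] at h1
  omega

theorem lvl_two {a x : ℕ} (h : x ∈ lvl (a + 1)) : x / 2 ∈ lvl a := by
  rw [mem_lvl] at *
  rw [pow_succ, pow_succ] at h
  rw [pow_succ]
  omega

variable {π πi : ℕ → ℕ → ℕ} {J M : ℕ}

theorem lvl_lt {a x : ℕ} (hM : M = 2 ^ J) (ha : a ≤ J) (h : x ∈ lvl a) : x < 2 * M := by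
  rw [mem_lvl, pow_succ] at h
  have : 2 ^ a ≤ 2 ^ J := Nat.pow_le_pow_right (by norm_num) ha
  omega

theorem BE_in (h : HeapExp π πi) (hM : M = 2 ^ J) (k : ℕ) {a x l : ℕ} (ha : a + 1 ≤ J)
    (hx : x ∈ lvl (a + 1)) (hl : l < 40) :
    BE (prC π πi M) (DC J M) (4 * M) (inId M k x) (inId M k (π l x / 2)) := by
  have hx2 := lvl_lt hM ha hx
  have hp := h.mem l _ _ hx
  have hp2 := lvl_two hp
  have hi := h.inv l _ _ hx
  have hlx := lvl_log hx
  have hlp := lvl_log hp2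
  have hpl := lvl_lt hM (by omega) hp
  have hq : π l x / 2 < x ∧ π l x / 2 < M := by
    rw [mem_lvl] at hp2 hx; omega
  have e1 : inId M k (π l x / 2) / (4 * M) = k := inId_div (by omega)
  have e2 : inId M k (π l x / 2) % (4 * M) = 2 * M - 1 - π l x / 2 := inId_mod (by omega)
  have e3 : 2 * M - 1 - (2 * M - 1 - π l x / 2) = π l x / 2 := by omega
  have rest : inId M k x < inId M k (π l x / 2) ∧ DC J M (inId M k x) < DC J M (inId M k (π l x / 2)) ∧
      inId M k (π l x / 2) / (4 * M) ≤ inId M k x / (4 * M) + 1 := by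
    refine ⟨?_, ?_, ?_⟩
    · unfold inId; omega
    · rw [DC_in hx2, DC_in (by omega), hlx, hlp]; omega
    · rw [e1, inId_div (by omega)]; omega
  by_cases hpar : π l x % 2 = 0
  · refine ⟨l, by omega, ?_, rest⟩
    unfold prC
    rw [e1, e2, e3, if_pos (by omega), if_pos hq.2, if_pos hl, show 2 * (π l x / 2) = π l x by omega, hi]
  · refine ⟨l + 40, by omega, ?_, rest⟩
    unfold prC
    rw [e1, e2, e3, if_pos (by omega), if_pos hq.2, if_neg (by omega), Nat.add_sub_cancel,
      show 2 * (π l x / 2) + 1 = π l x by omega, hi]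

theorem BE_out (h : HeapExp π πi) (hM : M = 2 ^ J) (k : ℕ) {a x l : ℕ} (ha : a + 1 ≤ J)
    (hx : x ∈ lvl (a + 1)) (hl : l < 40) :
    BE (prC π πi M) (DC J M) (4 * M) (outId M k (π l x / 2)) (outId M k x) := by
  have hx2 := lvl_lt hM ha hx
  have hp := h.mem l _ _ hx
  have hp2 := lvl_two hp
  have hlx := lvl_log hx
  have hlp := lvl_log hp2
  have hpl := lvl_lt hM (by omega) hp
  have hq : π l x / 2 < x := by
    rw [mem_lvl] at hp2 hx; omega
  have e1 : outId M k x / (4 * M) = k := outId_div (by omega)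
  have e2 : outId M k x % (4 * M) = 2 * M + x := outId_mod (by omega)
  refine ⟨l, by omega, ?_, ?_, ?_, ?_⟩
  · unfold prC
    rw [e1, e2, if_neg (by omega), if_pos hl, Nat.add_sub_cancel_left]
  · unfold outId; omega
  · rw [DC_out hx2, DC_out (by omega), hlx, hlp]; omega
  · rw [e1, outId_div (by omega)]; omega

theorem BE_mid (h : HeapExp π πi) (hM : M = 2 ^ J) (k : ℕ) {a x l : ℕ} (ha : a ≤ J)
    (hx : x ∈ lvl a) (hl : l < 40) :
    BE (prC π πi M) (DC J M) (4 * M) (inId M k x) (outId M k (π l x)) := by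
  have hx2 := lvl_lt hM ha hx
  have hp := h.mem l _ _ hx
  have hi := h.inv l _ _ hx
  have hlx := lvl_log hx
  have hlp := lvl_log hp
  have hpl := lvl_lt hM ha hp
  have e1 : outId M k (π l x) / (4 * M) = k := outId_div (by omega)
  have e2 : outId M k (π l x) % (4 * M) = 2 * M + π l x := outId_mod (by omega)
  refine ⟨l + 40, by omega, ?_, ?_, ?_, ?_⟩
  · unfold prC
    rw [e1, e2, if_neg (by omega), if_neg (by omega), Nat.add_sub_cancel_left, Nat.add_sub_cancel, hi]
  · unfold inId outId; omega
  · rw [DC_in hx2, DC_out (by omega), hlx, hlp]; omega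
  · rw [e1, inId_div (by omega)]; omega

theorem BE_next (hM : M = 2 ^ J) (k : ℕ) {x : ℕ} (hx : x ∈ lvl J) :
    BE (prC π πi M) (DC J M) (4 * M) (outId M k x) (inId M (k + 1) x) := by
  have hx2 := lvl_lt hM le_rfl hx
  have hlx := lvl_log hx
  have hx3 : M ≤ x := by rw [mem_lvl] at hx; omega
  have e1 : inId M (k + 1) x / (4 * M) = k + 1 := inId_div (by omega)
  have e2 : inId M (k + 1) x % (4 * M) = 2 * M - 1 - x := inId_mod (by omega)
  have e3 : 2 * M - 1 - (2 * M - 1 - x) = x := by omega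
  refine ⟨0, by omega, ?_, ?_, ?_, ?_⟩
  · unfold prC
    rw [e1, e2, e3, if_pos (by omega), if_neg (by omega), Nat.add_sub_cancel]
  · unfold inId outId
    rw [Nat.mul_succ]; omega
  · rw [DC_in hx2, DC_out hx2, hlx, add_mul]; omega
  · rw [e1, outId_div hx2]

end Base
section Recursion

theorem rec_split (N : ℕ → ℕ → ℕ) (T : ℕ) (hone : ∀ a b, a ≤ b → b < T → N a (b + 1) ≤ N a b + 1)
    (hz : ∀ a, N a a = 0) {c d q : ℕ} (hcd : c ≤ d) (hd : d ≤ T) (hq : q ≤ N c d) :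
    ∃ e, c ≤ e ∧ e ≤ d ∧ N c e = q := by
  induction d, hcd using Nat.le_induction with
  | base => exact ⟨c, le_rfl, le_rfl, by rw [hz] at *; omega⟩
  | succ d hcd ih =>
    by_cases h : q = N c (d + 1)
    · exact ⟨d + 1, by omega, le_rfl, h.symm⟩
    · have := hone c d hcd (by omega)
      obtain ⟨e, h1, h2, h3⟩ := ih (by omega) (by omega)
      exact ⟨e, h1, by omega, h3⟩

theorem rec_lb (N : ℕ → ℕ → ℕ → ℕ) (s : ℕ → ℕ → ℕ) (T S0 m σ A : ℕ)
    (hone : ∀ k a b, a ≤ b → b < T → N k a (b + 1) ≤ N k a b + 1)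
    (hz : ∀ k a, N k a a = 0)
    (hsub : ∀ k a b c, a ≤ b → b ≤ c → N k a c ≤ N k a b + N k b c)
    (hmono : ∀ k a a' b' b, a ≤ a' → a' ≤ b' → b' ≤ b → N k a' b' ≤ N k a b)
    (hs1 : ∀ k i, i < T → s k (i + 1) ≤ s k i + 1)
    (hm : S0 + 1 + A * (2 * σ + 2) ≤ m) (hA : 1 ≤ A) (r : ℕ)
    (hsS : ∀ k i, k < r → i ≤ T → s k i ≤ S0)
    (hB : ∀ k a b, k + 1 < r → a ≤ b → b ≤ T → s (k + 1) a < N (k + 1) a b → m ≤ N k a b) :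
    ∀ k, k < r → ∀ j a b, a ≤ b → b ≤ T →
      (∀ i, a ≤ i → i ≤ b → ∑ k' ∈ Finset.range (k + 1), s k' i < j * σ) →
      m ≤ N k a b → A ^ (k - j) ≤ b - a := by
  intro k
  induction k with
  | zero =>
    intro _ j a b hab hb _ hN
    rw [Nat.zero_sub, pow_zero]
    by_contra h
    have : b = a := by omega
    rw [this, hz] at hN
    omega
  | succ k ih =>
    intro hk j a b hab hb hsum hN
    obtain ⟨j, rfl⟩ : ∃ j', j = j' + 1 := by
      rcases j with _ | j
      · have := hsum a le_rfl hab
        omega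
      · exact ⟨j, rfl⟩
    have hsum' : ∀ i, a ≤ i → i ≤ b →
        ∑ k' ∈ Finset.range (k + 1), s k' i + s (k + 1) i < j * σ + σ := by
      intro i h1 h2
      have := hsum i h1 h2
      rw [Finset.sum_range_succ, add_mul, one_mul] at this
      exact this
    by_cases hA' : ∃ a' b', a ≤ a' ∧ a' ≤ b' ∧ b' ≤ b ∧ (∀ i, a' ≤ i → i ≤ b' → σ ≤ s (k + 1) i) ∧
        m ≤ N k a' b'
    · obtain ⟨a', b', h1, h2, h3, h4, h5⟩ := hA'
      have := ih (by omega) j a' b' h2 (by omega) (by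
        intro i hi1 hi2
        have := hsum' i (by omega) (by omega)
        have := h4 i hi1 hi2
        omega) h5
      rw [Nat.add_sub_add_right]
      omega
    · push Not at hA'
      have good : ∀ c d, a ≤ c → c ≤ d → d ≤ b → S0 + 1 ≤ N (k + 1) a c →
          2 * σ + 2 ≤ N (k + 1) c d → m ≤ N k c d := by
        intro c d hac hcd hdb hNc hNd
        obtain ⟨e, he1, he2, he3⟩ := rec_split (N (k + 1)) T (hone _) (hz _) hcd (by omega)
          (show σ + 1 ≤ N (k + 1) c d by omega)
        have hed := hsub (k + 1) c e d he1 he2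
        by_cases hg : ∃ u, c ≤ u ∧ u ≤ e ∧ s (k + 1) u < σ
        · obtain ⟨u, hu1, hu2, hu3⟩ := hg
          have h1 := hmono (k + 1) u e d d hu2 he2 le_rfl
          have h2 := hB k u d hk (by omega) (by omega) (by omega)
          exact h2.trans (hmono k c u d d hu1 (by omega) le_rfl)
        · exfalso
          push Not at hg
          -- maximal bad interval ending in `e`
          have hex : ∃ u, a ≤ u ∧ u ≤ c ∧ ∀ i, u ≤ i → i ≤ e → σ ≤ s (k + 1) i := ⟨c, hac, le_rfl, hg⟩
          classical
          obtain ⟨hu1, hu2, hu3⟩ := Nat.find_spec hex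
          have hmin := fun n => Nat.find_min hex (m := n)
          set u := Nat.find hex
          have hlt : s (k + 1) u < N (k + 1) u e := by
            by_cases hua : u = a
            · have h1 := hmono (k + 1) a a c e le_rfl hac he1
              have h2 := hsS (k + 1) a hk (by omega)
              rw [hua]; omega
            · have h3 : s (k + 1) (u - 1) < σ := by
                by_contra h
                push Not at h
                apply hmin (u - 1) (by omega)
                refine ⟨by omega, by omega, fun i hi1 hi2 => ?_⟩
                by_cases hi : i = u - 1
                · rw [hi]; exact h
                · exact hu3 i (by omega) hi2
              have h4 := hs1 (k + 1) (u - 1) (by omega)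
              rw [Nat.sub_add_cancel (by omega)] at h4
              have h5 := hmono (k + 1) u c e e hu2 he1 le_rfl
              omega
          have h6 := hB k u e hk (by omega) (by omega) hlt
          have h7 := hA' u e hu1 (by omega) (by omega) hu3
          omega
      have parts : ∀ p c, a ≤ c → c ≤ b → S0 + 1 ≤ N (k + 1) a c →
          p * (2 * σ + 2) ≤ N (k + 1) c b → p * A ^ (k - (j + 1)) ≤ b - c := by
        intro p
        induction p with
        | zero => intros; omega
        | succ p ihp =>
          intro c hac hcb hNc hNb
          rw [add_mul, one_mul] at hNb
          obtain ⟨d, hd1, hd2, hd3⟩ := rec_split (N (k + 1)) T (hone _) (hz _) hcb hb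
            (show 2 * σ + 2 ≤ N (k + 1) c b by omega)
          have h1 := hsub (k + 1) c d b hd1 hd2
          have h2 := ihp d (by omega) hd2
            (hNc.trans (hmono (k + 1) a a c d le_rfl hac hd1)) (by omega)
          have h3 := ih (by omega) (j + 1) c d hd1 (by omega) (by
            intro i hi1 hi2
            have := hsum' i (by omega) (by omega)
            rw [add_mul, one_mul]
            omega) (good c d hac hd1 hd2 hNc (by omega))
          rw [add_mul, one_mul]
          omega
      obtain ⟨c, hc1, hc2, hc3⟩ := rec_split (N (k + 1)) T (hone _) (hz _) hab hb
        (show S0 + 1 ≤ N (k + 1) a b by omega)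
      have h1 := hsub (k + 1) a c b hc1 hc2
      have h2 := parts A c hc1 hc2 (by omega) (by omega)
      have h3 : A ^ (k + 1 - (j + 1)) ≤ A * A ^ (k - (j + 1)) := by
        rw [← pow_succ']
        exact Nat.pow_le_pow_right hA (by omega)
      omega

end Recursion
section Lower
open FinDigraph

/-- `u` gets pebbled at some step in `[a, b)` -/
def PlIn {α : Type} (P : ℕ → Set α) (a b : ℕ) (u : α) : Prop :=
  ∃ i, a ≤ i ∧ i < b ∧ u ∉ P i ∧ u ∈ P (i + 1)

theorem PlIn.of_mem {α : Type} {P : ℕ → Set α} {a b : ℕ} {u : α} (hab : a ≤ b) (ha : u ∉ P a)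
    (hb : u ∈ P b) : PlIn P a b u := by
  induction b, hab using Nat.le_induction with
  | base => exact absurd hb ha
  | succ b hab ih =>
    by_cases h : u ∈ P b
    · obtain ⟨i, h1, h2, h3⟩ := ih h
      exact ⟨i, h1, by omega, h3⟩
    · exact ⟨b, hab, by omega, h, hb⟩

theorem PlIn.mono {α : Type} {P : ℕ → Set α} {a b a' b' : ℕ} {u : α} (ha : a' ≤ a) (hb : b ≤ b')
    (h : PlIn P a b u) : PlIn P a' b' u := by
  obtain ⟨i, h1, h2, h3⟩ := h
  exact ⟨i, by omega, by omega, h3⟩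

theorem StdMove.new {G : FinDigraph} {P Q : Set G.V} (h : G.StdMove P Q) {w : G.V} (h1 : w ∉ P)
    (h2 : w ∈ Q) : G.pred w ⊆ P ∧ ∀ w', w' ∈ Q → w' ∈ P ∨ w' = w := by
  rcases h with ⟨v, hv, hv', rfl⟩ | ⟨v, _, rfl⟩
  · rcases h2 with rfl | h2
    · refine ⟨hv, ?_⟩
      rintro w' (rfl | h)
      · exact Or.inr rfl
      · exact Or.inl h
    · exact absurd h2 h1
  · exact absurd h2.1 h1

theorem PlIn.edge {G : FinDigraph} {z : G.V} {t : ℕ} {P : ℕ → Set G.V} (hp : G.IsStdPebbling z t P)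
    {u w : G.V} (he : G.Edge u w) {a b : ℕ} (hb : b ≤ t) (hu : u ∉ P a) (hw : PlIn P a b w) :
    PlIn P a b u := by
  obtain ⟨i, h1, h2, h3, h4⟩ := hw
  have := (StdMove.new (hp.2.2.2 i (by omega)) h3 h4).1 he
  exact (PlIn.of_mem h1 hu this).mono le_rfl (by omega)

theorem Conn.notMem {π : ℕ → ℕ → ℕ} {QI QO : Finset ℕ} {a x y : ℕ} (h : Conn π QI QO a x y) :
    x ∉ QI ∧ y ∉ QO := by
  cases h <;> constructor <;> assumption

/-- connecting paths propagate placement backwards -/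
theorem Conn.prop {π : ℕ → ℕ → ℕ} {QI QO : Finset ℕ} {a x y J : ℕ} (h : Conn π QI QO a x y)
    (I O : ℕ → Prop) (ha : a ≤ J)
    (hmid : ∀ a x l, a ≤ J → l < 40 → x ∈ lvl a → x ∉ QI → π l x ∉ QO → O (π l x) → I x)
    (hin : ∀ a x l, a + 1 ≤ J → l < 40 → x ∈ lvl (a + 1) → x ∉ QI → π l x / 2 ∉ QI → I (π l x / 2) → I x)
    (hout : ∀ a x l, a + 1 ≤ J → l < 40 → x ∈ lvl (a + 1) → x ∉ QO → π l x / 2 ∉ QO →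
      O x → O (π l x / 2)) : O y → I x := by
  induction h with
  | direct a x l hl hx h1 h2 => exact hmid a x l ha hl hx h1 h2
  | step a x y l l' hl hl' hx hy h1 h2 hc ih =>
    intro hO
    exact hin a x l ha hl hx h1 hc.notMem.1
      (ih (by omega) (hout a y l' ha hl' hy h2 hc.notMem.2 hO))

theorem FG_lower {π πi : ℕ → ℕ → ℕ} (h : HeapExp π πi) {J M r : ℕ} (hM : M = 2 ^ J)
    (hpos : 0 < r * (4 * M)) (t : ℕ) (P : ℕ → Set (FG (prC π πi M) (DC J M) (4 * M) r).V)
    (hp : (FG (prC π πi M) (DC J M) (4 * M) r).IsStdPebbling (FGsink _ _ _ _ hpos) t P)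
    (S0 σ A j0 : ℕ) (hS : (FG (prC π πi M) (DC J M) (4 * M) r).space t P ≤ S0)
    (hj : S0 < j0 * σ) (hA : 1 ≤ A) (hm : 2 * S0 + 1 + A * (2 * σ + 2) ≤ M) :
    A ^ (r - 1 - j0) ≤ t := by
  classical
  obtain ⟨vl, mk, vlt, vinj, hmk, hE, hsk⟩ := FG_model (pr := prC π πi M) (D := DC J M) hpos
  have hM0 : 0 < M := by omega
  have hr : 0 < r := Nat.pos_of_mul_pos_right hpos
  have hP0 : P 0 = ∅ := hp.1
  -- occupied base vertices
  let Q : ℕ → Finset ℕ := fun i => (Finset.univ.filter (fun w => w ∈ P i)).image (fun w => vl w / 81)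
  have hQ : ∀ i v, v ∈ Q i ↔ ∃ w, w ∈ P i ∧ vl w / 81 = v := by
    intro i v; simp [Q]
  have hQc : ∀ i ≤ t, (Q i).card ≤ S0 := by
    intro i hi
    refine Finset.card_image_le.trans (le_trans ?_ hS)
    have h1 : (P i).ncard ≤ (FG (prC π πi M) (DC J M) (4 * M) r).space t P := by
      unfold space
      exact Finset.le_sup (f := fun i => (P i).ncard) (Finset.mem_range.2 (by omega))
    refine le_trans (le_of_eq ?_) h1
    rw [← Set.ncard_coe_finset]
    congr 1
    ext w; simp
  -- placed base vertices
  let pl : ℕ → ℕ → ℕ → Prop := fun a b v => ∃ w, vl w = 81 * v + 79 ∧ PlIn P a b w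
  have plmono : ∀ a a' b' b v, a ≤ a' → b' ≤ b → pl a' b' v → pl a b v := by
    rintro a a' b' b v h1 h2 ⟨w, hw, hw'⟩
    exact ⟨w, hw, hw'.mono h1 h2⟩
  have pledge : ∀ a b u v, b ≤ t → BE (prC π πi M) (DC J M) (4 * M) u v → u ∉ Q a → v ∉ Q a →
      pl a b v → pl a b u := by
    rintro a b u v hb ⟨l, hl, hpr, huv, hD, hblk⟩ hu hv ⟨w, hw, hpw⟩
    have hwlt := vlt w
    have desc : ∀ d, d ≤ 79 → ∀ w', vl w' = 81 * v + (79 - d) → PlIn P a b w' := by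
      intro d
      induction d with
      | zero =>
        intro _ w' hw'
        rwa [vinj w' w (by omega)]
      | succ d ih =>
        intro hd w' hw'
        have h1 := ih (by omega) (mk (81 * v + (79 - d)) (by omega)) (hmk _ _)
        refine PlIn.edge hp (w := mk (81 * v + (79 - d)) (by omega)) ?_ hb ?_ h1
        · rw [hE, hmk]
          left
          omega
        · intro hc
          exact hv ((hQ _ _).2 ⟨w', hc, by omega⟩)
    have h1 := desc (79 - l) (by omega) (mk (81 * v + l) (by omega)) (by rw [hmk]; omega)
    refine ⟨mk (81 * u + 79) (by omega), hmk _ _, PlIn.edge hp (w := mk (81 * v + l) (by omega)) ?_ hb ?_ h1⟩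
    · rw [hE, hmk, hmk]
      right; left
      have e1 : (81 * v + l) / 81 = v := by omega
      have e2 : (81 * v + l) % 81 = l := by omega
      have e3 : (81 * u + 79) / 81 = u := by omega
      rw [e1, e2, e3]
      exact ⟨hl, by omega, hpr, huv, hD, hblk⟩
    · intro hc
      exact hu ((hQ _ _).2 ⟨_, hc, by rw [hmk]; omega⟩)
  let s : ℕ → ℕ → ℕ := fun k i => ((Q i).filter (fun v => v / (4 * M) = k)).card
  let N : ℕ → ℕ → ℕ → ℕ := fun k a b => ((lvl J).filter (fun x => pl a b (outId M k x))).card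
  have lvlc : (lvl J).card = M := by
    unfold lvl
    rw [Nat.card_Ico, pow_succ, ← hM]; omega
  have hsum : ∀ i ≤ t, ∑ k ∈ Finset.range r, s k i ≤ S0 := by
    intro i hi
    refine le_trans (le_of_eq ?_) (hQc i hi)
    symm
    apply Finset.card_eq_sum_card_fiberwise
    intro v hv
    obtain ⟨w, _, rfl⟩ := (hQ _ _).1 hv
    have := vlt w
    simp only [Finset.coe_range, Set.mem_Iio]
    rw [Nat.div_lt_iff_lt_mul (by omega)]
    omega
  have hsub : ∀ k a b c, a ≤ b → b ≤ c → N k a c ≤ N k a b + N k b c := by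
    intro k a b c hab hbc
    refine le_trans (Finset.card_le_card ?_) (Finset.card_union_le _ _)
    intro x hx
    simp only [Finset.mem_union, Finset.mem_filter] at hx ⊢
    obtain ⟨hx1, w, hw, i, h1, h2, h3⟩ := hx
    by_cases hi : i < b
    · exact Or.inl ⟨hx1, w, hw, i, h1, hi, h3⟩
    · exact Or.inr ⟨hx1, w, hw, i, by omega, h2, h3⟩
  have hN1 : ∀ k b, b < t → N k b (b + 1) ≤ 1 := by
    intro k b hb
    rw [Finset.card_le_one]
    intro x hx y hy
    simp only [Finset.mem_filter] at hx hy
    obtain ⟨_, w, hw, i, h1, h2, h3, h4⟩ := hx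
    obtain ⟨_, w', hw', i', h1', h2', h3', h4'⟩ := hy
    obtain rfl : i = b := by omega
    obtain rfl : i' = i := by omega
    have := ((StdMove.new (hp.2.2.2 i' hb) h3 h4).2 w' h4').resolve_left h3'
    rw [this] at hw'
    unfold outId at hw hw'
    omega
  have hmono : ∀ k a a' b' b, a ≤ a' → a' ≤ b' → b' ≤ b → N k a' b' ≤ N k a b := by
    intro k a a' b' b h1 _ h2
    apply Finset.card_le_card
    intro x hx
    simp only [Finset.mem_filter] at hx ⊢
    exact ⟨hx.1, plmono _ _ _ _ _ h1 h2 hx.2⟩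
  have hs1 : ∀ k i, i < t → s k (i + 1) ≤ s k i + 1 := by
    intro k i hi
    by_cases hnew : ∃ w, w ∉ P i ∧ w ∈ P (i + 1)
    · obtain ⟨w, hw1, hw2⟩ := hnew
      have hn := (StdMove.new (hp.2.2.2 i hi) hw1 hw2).2
      refine le_trans (Finset.card_le_card (t := insert (vl w / 81)
        ((Q i).filter (fun v => v / (4 * M) = k))) ?_) (Finset.card_insert_le _ _)
      intro v hv
      rw [Finset.mem_filter, hQ] at hv
      obtain ⟨⟨w', hw', hv1⟩, hv2⟩ := hv
      rw [Finset.mem_insert, Finset.mem_filter, hQ]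
      rcases hn w' hw' with h | rfl
      · exact Or.inr ⟨⟨w', h, hv1⟩, hv2⟩
      · exact Or.inl hv1.symm
    · push Not at hnew
      refine le_trans (Finset.card_le_card ?_) (Nat.le_succ _)
      intro v hv
      rw [Finset.mem_filter, hQ] at hv ⊢
      obtain ⟨⟨w', hw', hv1⟩, hv2⟩ := hv
      refine ⟨⟨w', ?_, hv1⟩, hv2⟩
      by_contra hc
      exact hnew w' hc hw'
  have hsS : ∀ k i, k < r → i ≤ t → s k i ≤ S0 := by
    intro k i hk hi
    exact le_trans (Finset.single_le_sum (f := fun k => s k i) (fun _ _ => Nat.zero_le _)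
      (Finset.mem_range.2 hk)) (hsum i hi)
  have hB : ∀ k a b, k + 1 < r → a ≤ b → b ≤ t → s (k + 1) a < N (k + 1) a b → M - S0 ≤ N k a b := by
    intro k a b hk hab hb hlt
    let QI := (Finset.range (2 * M)).filter (fun x => inId M (k + 1) x ∈ Q a)
    let QO := (Finset.range (2 * M)).filter (fun x => outId M (k + 1) x ∈ Q a)
    have mQI : ∀ x, x < 2 * M → x ∉ QI → inId M (k + 1) x ∉ Q a := by
      intro x hx h1 h2
      exact h1 (Finset.mem_filter.2 ⟨Finset.mem_range.2 hx, h2⟩)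
    have mQO : ∀ x, x < 2 * M → x ∉ QO → outId M (k + 1) x ∉ Q a := by
      intro x hx h1 h2
      exact h1 (Finset.mem_filter.2 ⟨Finset.mem_range.2 hx, h2⟩)
    have hQQ : (QI.filter (· < 2 ^ (J + 1))).card + (QO.filter (· < 2 ^ (J + 1))).card ≤ s (k + 1) a := by
      refine le_trans (add_le_add (Finset.card_filter_le _ _) (Finset.card_filter_le _ _)) ?_
      have i1 : Set.InjOn (inId M (k + 1)) (QI : Set ℕ) := by
        intro x hx y hy hxy
        simp only [QI, Finset.coe_filter, Finset.mem_range, Set.mem_ofPred_eq] at hx hy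
        unfold inId at hxy; omega
      have i2 : Set.InjOn (outId M (k + 1)) (QO : Set ℕ) := by
        intro x hx y hy hxy
        unfold outId at hxy; omega
      rw [← Finset.card_image_of_injOn i1, ← Finset.card_image_of_injOn i2, ← Finset.card_union_of_disjoint]
      · apply Finset.card_le_card
        intro v hv
        rw [Finset.mem_union, Finset.mem_image, Finset.mem_image] at hv
        rw [Finset.mem_filter]
        rcases hv with ⟨x, hx, rfl⟩ | ⟨x, hx, rfl⟩
        · rw [Finset.mem_filter, Finset.mem_range] at hx
          exact ⟨hx.2, inId_div hM0⟩
        · rw [Finset.mem_filter, Finset.mem_range] at hx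
          exact ⟨hx.2, outId_div hx.1⟩
      · rw [Finset.disjoint_left]
        intro v hv hv'
        rw [Finset.mem_image] at hv hv'
        obtain ⟨x, hx, rfl⟩ := hv
        obtain ⟨y, hy, hxy⟩ := hv'
        unfold inId outId at hxy
        omega
    let X := (lvl J).filter (fun x => ¬ pl a b (outId M k x) ∧ outId M k x ∉ Q a)
    have hX : X.card ≤ s (k + 1) a := by
      by_contra hcon
      push Not at hcon
      obtain ⟨x, hx, y, hy, hc⟩ := superconc h QI QO J X
        ((lvl J).filter (fun x => pl a b (outId M (k + 1) x))) (Finset.filter_subset _ _)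
        (Finset.filter_subset _ _) (lt_of_le_of_lt hQQ hcon) (lt_of_le_of_lt hQQ hlt)
      rw [Finset.mem_filter] at hx hy
      have hx2 := lvl_lt hM le_rfl hx.1
      have key := hc.prop (J := J) (fun x => pl a b (inId M (k + 1) x))
        (fun x => pl a b (outId M (k + 1) x)) le_rfl
        (by
          intro a' x l ha hl hx h1 h2
          have q1 := lvl_lt hM ha hx
          have q2 := lvl_lt hM ha (h.mem l _ _ hx)
          exact pledge a b _ _ hb (BE_mid h hM (k + 1) ha hx hl) (mQI _ q1 h1) (mQO _ q2 h2))
        (by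
          intro a' x l ha hl hx h1 h2
          have q1 := lvl_lt hM ha hx
          have q2 := lvl_lt hM (by omega) (lvl_two (h.mem l _ _ hx))
          exact pledge a b _ _ hb (BE_in h hM (k + 1) ha hx hl) (mQI _ q1 h1) (mQI _ q2 h2))
        (by
          intro a' x l ha hl hx h1 h2
          have q1 := lvl_lt hM ha hx
          have q2 := lvl_lt hM (by omega) (lvl_two (h.mem l _ _ hx))
          exact pledge a b _ _ hb (BE_out h hM (k + 1) ha hx hl) (mQO _ q2 h2) (mQO _ q1 h1))
        hy.2
      exact hx.2.1 (pledge a b _ _ hb (BE_next hM k hx.1) hx.2.2 (mQI _ hx2 hc.notMem.1) key)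
    let Z := (lvl J).filter (fun x => outId M k x ∈ Q a)
    have hZ : Z.card ≤ s k a := by
      have i2 : Set.InjOn (outId M k) (Z : Set ℕ) := by
        intro x hx y hy hxy
        unfold outId at hxy; omega
      rw [← Finset.card_image_of_injOn i2]
      apply Finset.card_le_card
      intro v hv
      rw [Finset.mem_image] at hv
      obtain ⟨x, hx, rfl⟩ := hv
      rw [Finset.mem_filter] at hx ⊢
      exact ⟨hx.2, outId_div (lvl_lt hM le_rfl hx.1)⟩
    have hcov : M ≤ N k a b + (Z.card + X.card) := by
      rw [← lvlc]
      refine le_trans (Finset.card_le_card (t := (lvl J).filter (fun x => pl a b (outId M k x)) ∪ (Z ∪ X)) ?_)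
        ((Finset.card_union_le _ _).trans (Nat.add_le_add_left (Finset.card_union_le _ _) _))
      intro x hx
      simp only [Z, X, Finset.mem_union, Finset.mem_filter, hx, true_and]
      tauto
    have h2 : s k a + s (k + 1) a ≤ S0 := by
      refine le_trans ?_ (hsum a (by omega))
      have : ∑ k' ∈ ({k, k + 1} : Finset ℕ), s k' a ≤ ∑ k' ∈ Finset.range r, s k' a := by
        apply Finset.sum_le_sum_of_subset
        intro k' hk'
        simp only [Finset.mem_insert, Finset.mem_singleton] at hk'
        rw [Finset.mem_range]; omega
      rwa [Finset.sum_pair (by omega)] at this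
    omega
  -- every vertex is placed
  have hall : ∀ d, ∀ w, vl w + d + 1 = r * (4 * M) * 81 → PlIn P 0 t w := by
    intro d
    induction d using Nat.strong_induction_on with
    | _ d ih =>
      intro w hw
      by_cases hd : d = 0
      · obtain ⟨i, hi, hz⟩ := hp.2.2.1
        have : w = FGsink _ _ _ _ hpos := vinj _ _ (by rw [hsk]; omega)
        rw [this]
        exact (PlIn.of_mem (Nat.zero_le i) (by rw [hP0]; exact fun h => h) hz).mono le_rfl hi
      · obtain ⟨w', hw', he⟩ := FE_succ (pr := prC π πi M) (D := DC J M) (B := 4 * M) (vl w)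
          (r * (4 * M)) (vlt w) (by omega)
        have hlt := he.lt
        have h1 := ih (r * (4 * M) * 81 - 1 - w') (by omega) (mk w' hw') (by rw [hmk]; omega)
        exact PlIn.edge hp (by rw [hE, hmk]; exact he) le_rfl (by rw [hP0]; exact fun h => h) h1
  have hNtop : N (r - 1) 0 t = M := by
    rw [← lvlc]
    show (Finset.filter _ _).card = _
    rw [Finset.filter_true_of_mem]
    intro x hx
    have hx2 := lvl_lt hM le_rfl hx
    have hlt : 81 * outId M (r - 1) x + 79 < r * (4 * M) * 81 := by
      obtain ⟨r', rfl⟩ : ∃ r', r = r' + 1 := ⟨r - 1, by omega⟩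
      unfold outId
      rw [Nat.add_sub_cancel, add_mul, one_mul, mul_comm r']
      omega
    exact ⟨mk _ hlt, hmk _ _, hall (r * (4 * M) * 81 - 1 - (81 * outId M (r - 1) x + 79)) _
      (by rw [hmk]; omega)⟩
  have := rec_lb N s t S0 (M - S0) σ A
    (fun k a b hab hb => (hsub k a b (b + 1) hab (by omega)).trans (Nat.add_le_add_left (hN1 k b hb) _))
    (fun k a => by
      show (Finset.filter _ _).card = 0
      rw [Finset.card_eq_zero, Finset.filter_eq_empty_iff]
      rintro x _ ⟨w, _, i, h1, h2, _⟩
      omega)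
    hsub hmono hs1 (by omega) hA r hsS hB (r - 1) (by omega) j0 0 t (Nat.zero_le _) le_rfl
    (by
      intro i _ hi
      rw [Nat.sub_add_cancel hr]
      exact lt_of_le_of_lt (hsum i hi) hj)
    (by rw [hNtop]; omega)
  simpa using this

end Lower
section Asymptotics
open FinDigraph

/-- number of blocks -/
def rN (n : ℕ) : ℕ := Nat.log 2 n + 1
/-- height of the blocks -/
def JN (n : ℕ) : ℕ := Nat.log 2 (n / rN n)
/-- width of the blocks -/
def MN (n : ℕ) : ℕ := 2 ^ JN n

theorem MN_pos (n : ℕ) : 0 < MN n := by unfold MN; positivity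
theorem rN_pos (n : ℕ) : 0 < rN n := by unfold rN; omega
theorem posN (n : ℕ) : 0 < rN n * (4 * MN n) := by
  have := MN_pos n
  have := rN_pos n
  positivity

theorem rN_le {n : ℕ} (hn : 1 ≤ n) : rN n ≤ n := by
  have h1 : 2 ^ Nat.log 2 n ≤ n := Nat.pow_log_le_self 2 (by omega)
  have h2 : Nat.log 2 n < 2 ^ Nat.log 2 n := Nat.lt_two_pow_self
  unfold rN; omega

theorem MN_up {n : ℕ} (hn : 1 ≤ n) : rN n * MN n ≤ n := by
  have h0 : 0 < n / rN n := Nat.div_pos (rN_le hn) (rN_pos n)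
  have h1 : MN n ≤ n / rN n := Nat.pow_log_le_self 2 (by omega)
  calc rN n * MN n ≤ rN n * (n / rN n) := Nat.mul_le_mul_left _ h1
    _ ≤ n := Nat.mul_div_le _ _

theorem MN_low (n : ℕ) : n < 2 * (rN n * MN n) := by
  have h1 : n / rN n < 2 ^ (JN n + 1) := Nat.lt_pow_succ_log_self (by norm_num) _
  have h2 : n / rN n < 2 * MN n := by unfold MN; rw [pow_succ] at h1; omega
  rw [Nat.div_lt_iff_lt_mul (rN_pos n)] at h2
  calc n < _ := h2
    _ = _ := by ring

theorem JN_le {n : ℕ} : JN n + 1 ≤ rN n := by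
  unfold JN
  have : Nat.log 2 (n / rN n) ≤ Nat.log 2 n := Nat.log_mono_right (Nat.div_le_self _ _)
  unfold rN at *; omega

theorem rN_pow (n : ℕ) : n < 2 ^ rN n := Nat.lt_pow_succ_log_self (by norm_num) _

theorem rN_log {n : ℕ} (hn : 2 ≤ n) : 1 ≤ Real.logb 2 n ∧ Real.logb 2 n ≤ rN n ∧
    (rN n : ℝ) ≤ 2 * Real.logb 2 n := by
  have hn0 : (0 : ℝ) < n := by positivity
  have h1 : 1 ≤ Real.logb 2 n := by
    rw [Real.le_logb_iff_rpow_le (by norm_num) hn0, Real.rpow_one]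
    exact_mod_cast hn
  have h2 : Real.logb 2 n ≤ rN n := by
    rw [Real.logb_le_iff_le_rpow (by norm_num) hn0, Real.rpow_natCast]
    exact_mod_cast (rN_pow n).le
  have h3 : (Nat.log 2 n : ℝ) ≤ Real.logb 2 n := by
    rw [Real.le_logb_iff_rpow_le (by norm_num) hn0, Real.rpow_natCast]
    exact_mod_cast Nat.pow_log_le_self 2 (by omega)
  refine ⟨h1, h2, ?_⟩
  unfold rN
  push_cast
  linarith

theorem lower_nat {π πi : ℕ → ℕ → ℕ} (h : HeapExp π πi) {J M r : ℕ} (hM : M = 2 ^ J)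
    (hpos : 0 < r * (4 * M)) (t : ℕ) (P : ℕ → Set (FG (prC π πi M) (DC J M) (4 * M) r).V)
    (hp : (FG (prC π πi M) (DC J M) (4 * M) r).IsStdPebbling (FGsink _ _ _ _ hpos) t P)
    (hS : (FG (prC π πi M) (DC J M) (4 * M) r).space t P ≤ M / 16) (hr : 100 ≤ r) (hMr : r < M) :
    ∃ A e : ℕ, r ≤ A * A ∧ r ≤ 4 * e ∧ A ^ e ≤ t := by
  obtain ⟨A, hA⟩ : ∃ A, A = r / 8 := ⟨_, rfl⟩
  obtain ⟨j0, hj0⟩ : ∃ j0, j0 = r / 2 := ⟨_, rfl⟩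
  obtain ⟨S0, hS0⟩ : ∃ S0, S0 = M / 16 := ⟨_, rfl⟩
  rw [← hS0] at hS
  have hj : S0 < j0 * (S0 / j0 + 1) := Nat.lt_mul_div_succ _ (by omega)
  have h1 : j0 * (S0 / j0) ≤ S0 := Nat.mul_div_le _ _
  have h2 : 4 * A * (S0 / j0) ≤ j0 * (S0 / j0) := Nat.mul_le_mul_right _ (by omega)
  have h3 : A * (2 * (S0 / j0 + 1) + 2) = 2 * (A * (S0 / j0)) + 4 * A := by ring
  rw [mul_assoc] at h2
  refine ⟨A, r - 1 - j0, ?_, by omega, FG_lower h hM hpos t P hp S0 (S0 / j0 + 1) A j0 hS hj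
    (by omega) (by omega)⟩
  have h4 : 12 ≤ A := by omega
  have h5 : r ≤ 8 * A + 7 := by omega
  nlinarith

theorem large_pow {r : ℕ} (hr : 100 ≤ r) : 2 * (r * r) ≤ 2 ^ (r - 1) := by
  induction r, hr using Nat.le_induction with
  | base => norm_num
  | succ r hr ih =>
    obtain ⟨q, rfl⟩ : ∃ q, r = q + 1 := ⟨r - 1, by omega⟩
    rw [Nat.add_sub_cancel] at *
    rw [pow_succ]
    nlinarith

/-- threshold -/
def BN : ℕ := 2 ^ 100

theorem two_le_BN : 2 ≤ BN := by unfold BN; norm_num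

theorem MN_large {n : ℕ} (hn : BN ≤ n) : 100 ≤ rN n ∧ rN n < MN n := by
  have h1 : 100 ≤ Nat.log 2 n := Nat.le_log_of_pow_le (by norm_num) (by unfold BN at hn; exact hn)
  have hr : 100 ≤ rN n := by unfold rN; omega
  refine ⟨hr, ?_⟩
  have h2 := large_pow hr
  have h3 : 2 ^ (rN n - 1) ≤ n := Nat.pow_log_le_self 2 (by have := two_le_BN; omega)
  have h4 := MN_low n
  have h5 : rN n * rN n < rN n * MN n := by omega
  exact lt_of_mul_lt_mul_left h5 (Nat.zero_le _)

theorem main_time {n A e t : ℕ} (hn : 2 ≤ n) (h1 : rN n ≤ A * A) (h2 : rN n ≤ 4 * e) (h3 : A ^ e ≤ t) :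
    (n : ℝ) ^ ((1 / 8 : ℝ) * Real.logb 2 (Real.logb 2 n)) ≤ (t : ℝ) := by
  obtain ⟨hl1, hl2, _⟩ := rN_log hn
  set ℓ := Real.logb 2 n with hℓ
  have hn0 : (0 : ℝ) < n := by positivity
  have e1 : (n : ℝ) = 2 ^ ℓ := (Real.rpow_logb (by norm_num) (by norm_num) hn0).symm
  have e2 : (2 : ℝ) ^ Real.logb 2 ℓ = ℓ := Real.rpow_logb (by norm_num) (by norm_num) (by linarith)
  have e3 : (n : ℝ) ^ ((1 / 8 : ℝ) * Real.logb 2 ℓ) = ℓ ^ (ℓ / 8) := by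
    rw [e1, ← Real.rpow_mul (by norm_num), show ℓ * ((1 / 8 : ℝ) * Real.logb 2 ℓ) =
      Real.logb 2 ℓ * (ℓ / 8) by ring, Real.rpow_mul (by norm_num), e2]
  rw [e3]
  have hA : ℓ ≤ (A : ℝ) * A := by
    have : (rN n : ℝ) ≤ A * A := by exact_mod_cast h1
    linarith
  have he : ℓ / 8 ≤ (e : ℝ) / 2 := by
    have : (rN n : ℝ) ≤ 4 * e := by exact_mod_cast h2
    linarith
  calc ℓ ^ (ℓ / 8) ≤ ℓ ^ ((e : ℝ) / 2) := Real.rpow_le_rpow_of_exponent_le hl1 he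
    _ ≤ ((A : ℝ) * A) ^ ((e : ℝ) / 2) := Real.rpow_le_rpow (by linarith) hA (by positivity)
    _ = (A : ℝ) ^ (e : ℝ) := by
      rw [← pow_two, ← Real.rpow_natCast, ← Real.rpow_mul (by positivity)]
      congr 1
      push_cast
      ring
    _ ≤ t := by
      rw [Real.rpow_natCast]
      exact_mod_cast h3

theorem main_linear (δ : ℝ) (hδ : 0 < δ) : ∃ k : ℕ, ∃ C : ℝ, 0 < C ∧ ∀ n : ℕ, 2 ≤ n → ∃ b : ℕ,
    1 ≤ b ∧ rN n ≤ b ^ k ∧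
    ((2 * ((2 * b) ^ k * (81 * (4 * MN n))) : ℕ) : ℝ) ≤ C * n ∧
    ((81 * (4 * MN n) + k * (b * (81 * (4 * MN n))) : ℕ) : ℝ) ≤
      C * n / (Real.logb 2 n) ^ ((1 : ℝ) - δ) := by
  obtain ⟨k, hk⟩ := exists_nat_gt (1 / δ)
  have hk0 : (0 : ℝ) < k := lt_trans (by positivity) hk
  have hkN : k ≠ 0 := by rintro rfl; simp at hk0
  have hk1 : (1 : ℝ) ≤ k := by exact_mod_cast Nat.one_le_iff_ne_zero.2 hkN
  have hkδ : (1 : ℝ) / k ≤ δ := by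
    rw [div_le_iff₀ hk0]
    rw [div_lt_iff₀ hδ] at hk
    linarith
  refine ⟨k, 648 * 4 ^ k + 972 * k * 2 ^ δ, by positivity, fun n hn => ?_⟩
  obtain ⟨hl1, hl2, hl3⟩ := rN_log hn
  set ℓ := Real.logb 2 n with hℓ
  have hup : (rN n : ℝ) * MN n ≤ n := by exact_mod_cast MN_up (by omega : 1 ≤ n)
  set r : ℝ := ((rN n : ℕ) : ℝ) with hr
  set M : ℝ := ((MN n : ℕ) : ℝ) with hM
  have hM0 : 0 ≤ M := by positivity
  have hr1 : 1 ≤ r := by linarith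
  set ρ : ℝ := r ^ ((1 : ℝ) / k) with hρ
  have hρ1 : 1 ≤ ρ := Real.one_le_rpow hr1 (by positivity)
  have hρk : ρ ^ k = r := by
    rw [hρ, ← Real.rpow_natCast, ← Real.rpow_mul (by linarith), one_div, inv_mul_cancel₀ hk0.ne',
      Real.rpow_one]
  have hb1 : ρ ≤ (⌈ρ⌉₊ : ℝ) := Nat.le_ceil _
  have hb2 : (⌈ρ⌉₊ : ℝ) ≤ 2 * ρ := by
    have := Nat.ceil_lt_add_one (show 0 ≤ ρ by linarith)
    linarith
  have hρδ : ρ ≤ 2 ^ δ * ℓ ^ δ := by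
    rw [← Real.mul_rpow (by norm_num) (by linarith)]
    calc ρ ≤ r ^ δ := Real.rpow_le_rpow_of_exponent_le hr1 hkδ
      _ ≤ _ := Real.rpow_le_rpow (by linarith) hl3 hδ.le
  have hMℓ : M * ℓ ≤ n := by
    have : M * ℓ ≤ M * r := mul_le_mul_of_nonneg_left hl2 hM0
    linarith
  refine ⟨⌈ρ⌉₊, ?_, ?_, ?_, ?_⟩
  · exact_mod_cast hρ1.trans hb1
  · have : r ≤ (⌈ρ⌉₊ : ℝ) ^ k := by
      rw [← hρk]
      exact pow_le_pow_left₀ (by linarith) hb1 k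
    rw [hr] at this
    exact_mod_cast this
  · push_cast
    have h1 : (2 * (⌈ρ⌉₊ : ℝ)) ^ k ≤ 4 ^ k * r := by
      rw [← hρk, ← mul_pow]
      exact pow_le_pow_left₀ (by positivity) (by linarith) k
    have h2 : (2 * (⌈ρ⌉₊ : ℝ)) ^ k * M ≤ 4 ^ k * n := by
      calc (2 * (⌈ρ⌉₊ : ℝ)) ^ k * M ≤ 4 ^ k * r * M := mul_le_mul_of_nonneg_right h1 hM0
        _ = 4 ^ k * (r * M) := by ring
        _ ≤ 4 ^ k * n := mul_le_mul_of_nonneg_left hup (by positivity)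
    have h3 : 0 ≤ 972 * (k : ℝ) * 2 ^ δ * n := by positivity
    rw [add_mul]
    nlinarith
  · push_cast
    rw [le_div_iff₀ (Real.rpow_pos_of_pos (by linarith) _), Real.rpow_sub (by linarith), Real.rpow_one]
    have hℓδ : 0 < ℓ ^ δ := Real.rpow_pos_of_pos (by linarith) _
    have h1 : 81 * (4 * M) + k * (⌈ρ⌉₊ * (81 * (4 * M))) ≤ 972 * k * (ρ * M) := by
      have h2 : (⌈ρ⌉₊ : ℝ) * M ≤ 2 * ρ * M := mul_le_mul_of_nonneg_right hb2 hM0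
      have h3 : (k : ℝ) * ((⌈ρ⌉₊ : ℝ) * M) ≤ k * (2 * ρ * M) := mul_le_mul_of_nonneg_left h2 hk0.le
      have h4 : 1 * M ≤ (k * ρ) * M := mul_le_mul_of_nonneg_right (by nlinarith) hM0
      nlinarith
    have h5 : ρ * (ℓ / ℓ ^ δ) ≤ 2 ^ δ * ℓ := by
      rw [mul_div_assoc', div_le_iff₀ hℓδ]
      nlinarith
    have h0 : 0 ≤ ℓ / ℓ ^ δ := by positivity
    calc (81 * (4 * M) + k * (⌈ρ⌉₊ * (81 * (4 * M)))) * (ℓ / ℓ ^ δ)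
        ≤ 972 * k * (ρ * M) * (ℓ / ℓ ^ δ) := mul_le_mul_of_nonneg_right h1 h0
      _ = 972 * k * M * (ρ * (ℓ / ℓ ^ δ)) := by ring
      _ ≤ 972 * k * M * (2 ^ δ * ℓ) := mul_le_mul_of_nonneg_left h5 (by positivity)
      _ = 972 * k * 2 ^ δ * (M * ℓ) := by ring
      _ ≤ 972 * k * 2 ^ δ * n := mul_le_mul_of_nonneg_left hMℓ (by positivity)
      _ ≤ _ := by
        have : 0 ≤ 648 * 4 ^ k * (n : ℝ) := by positivity
        rw [add_mul]
        linarith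

theorem price_arith {r J : ℕ} (h1 : J + 1 ≤ r) (h2 : 0 < r) :
    3 * (81 * (r * (2 * J + 4))) + 2 + 2 * (r + 2) ≤ 980 * (r * r) := by
  have h3 : r * (2 * J + 4) ≤ r * (4 * r) := Nat.mul_le_mul_left _ (by omega)
  have h4 : r * (4 * r) = 4 * (r * r) := by ring
  have h5 : r * 1 ≤ r * r := Nat.mul_le_mul_left _ h2
  omega

end Asymptotics

/-- There is a family of single-sink DAGs `G_n` of in-degree at most 2 and
`Θ(n)` vertices such that: (1) the reversible pebbling price of `G_n` is `O(log² n)`;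
(2) for every `δ > 0` there is a reversible pebbling with time `O(n)` and space
`O(n / log^{1-δ} n)`; (3) there is a `K > 0` such that every standard pebbling with space at
most `K n / log n` has time `n^{Ω(log log n)}`. -/
theorem reversible_pebbling_robust_tradeoff :
    ∃ (G : ℕ → FinDigraph) (z : ∀ n, (G n).V),
      (∀ n, (G n).Acyclic ∧ (G n).UniqueSink (z n) ∧ ∀ v, ((G n).pred v).ncard ≤ 2) ∧
      (∃ a b : ℝ, 0 < a ∧ 0 < b ∧ ∀ n : ℕ, 1 ≤ n →
        a * n ≤ (Fintype.card (G n).V : ℝ) ∧ (Fintype.card (G n).V : ℝ) ≤ b * n) ∧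
      -- (1) reversible pebbling price O(log² n)
      (∃ C : ℝ, 0 < C ∧ ∃ N : ℕ, ∀ n : ℕ, N ≤ n →
        ∃ t P, (G n).IsRevPebbling (z n) t P ∧
          ((G n).space t P : ℝ) ≤ C * (Real.logb 2 n) ^ 2) ∧
      -- (2) reversible pebbling with time O(n) and space O(n / log^{1-δ} n)
      (∀ δ : ℝ, 0 < δ → ∃ C : ℝ, 0 < C ∧ ∃ N : ℕ, ∀ n : ℕ, N ≤ n →
        ∃ t P, (G n).IsRevPebbling (z n) t P ∧
          (t : ℝ) ≤ C * (n : ℝ) ∧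
          ((G n).space t P : ℝ) ≤ C * (n : ℝ) / (Real.logb 2 n) ^ ((1 : ℝ) - δ)) ∧
      -- (3) time n^{Ω(log log n)} for standard pebblings of space at most K n / log n
      (∃ K : ℝ, 0 < K ∧ ∃ c : ℝ, 0 < c ∧ ∃ N : ℕ, ∀ n : ℕ, N ≤ n →
        ∀ t P, (G n).IsStdPebbling (z n) t P →
          ((G n).space t P : ℝ) ≤ K * (n : ℝ) / Real.logb 2 n →
          (n : ℝ) ^ (c * Real.logb 2 (Real.logb 2 n)) ≤ (t : ℝ)) := by
  obtain ⟨π, πi, h⟩ := exists_heapExp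
  refine ⟨fun n => FG (prC π πi (MN n)) (DC (JN n) (MN n)) (4 * MN n) (rN n),
    fun n => FGsink _ _ _ _ (posN n), ?_, ?_, ?_, ?_, ?_⟩
  · intro n
    exact ⟨FG_acyclic, FG_sink _, FG_indeg⟩
  · refine ⟨162, 324, by norm_num, by norm_num, fun n hn => ?_⟩
    have h1 : (n : ℝ) ≤ 2 * (rN n * MN n) := by exact_mod_cast (MN_low n).le
    have h2 : (rN n * MN n : ℝ) ≤ n := by exact_mod_cast MN_up hn
    rw [FG_card]
    push_cast
    constructor <;> nlinarith
  · refine ⟨3920, by norm_num, 2, fun n hn => ?_⟩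
    have hk : rN n * (4 * MN n) ≤ 2 ^ (rN n + 2) := by
      have h1 := MN_up (by omega : 1 ≤ n)
      have h2 := rN_pow n
      have h3 : rN n * (4 * MN n) = 4 * (rN n * MN n) := by ring
      rw [pow_add]
      omega
    obtain ⟨t, P, hp, hs⟩ := FG_price (pr := prC π πi (MN n)) (posN n) (rN n * (2 * JN n + 4))
      (rN n + 2) (fun v hv => DC_lt rfl hv) hk
    refine ⟨t, P, hp, ?_⟩
    obtain ⟨hl1, hl2, hl3⟩ := rN_log hn
    have h1 : FinDigraph.space _ t P ≤ 980 * (rN n * rN n) := by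
      refine hs.trans ?_
      exact price_arith (JN_le (n := n)) (rN_pos n)
    have h2 : ((FinDigraph.space _ t P : ℕ) : ℝ) ≤ 980 * (rN n * rN n) := by exact_mod_cast h1
    refine h2.trans ?_
    nlinarith
  · intro δ hδ
    obtain ⟨k, C, hC, hb⟩ := main_linear δ hδ
    refine ⟨C, hC, 2, fun n hn => ?_⟩
    obtain ⟨b, hb1, hb2, hb3, hb4⟩ := hb n hn
    obtain ⟨t, P, hp, ht, hs⟩ := FG_linear (pr := prC π πi (MN n)) (D := DC (JN n) (MN n)) (rN_pos n)
      (by have := MN_pos n; omega) (posN n) b k hb1 hb2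
    refine ⟨t, P, hp, le_trans ?_ hb3, le_trans ?_ hb4⟩
    · exact_mod_cast ht
    · exact_mod_cast hs
  · refine ⟨1 / 64, by norm_num, 1 / 8, by norm_num, BN, fun n hn t P hp hs => ?_⟩
    obtain ⟨hr, hMr⟩ := MN_large hn
    have hn2 : 2 ≤ n := (two_le_BN).trans hn
    obtain ⟨hl1, hl2, hl3⟩ := rN_log hn2
    have hlow : (n : ℝ) ≤ 2 * (rN n * MN n) := by exact_mod_cast (MN_low n).le
    have hS : FinDigraph.space _ t P ≤ MN n / 16 := by
      rw [Nat.le_div_iff_mul_le (by norm_num)]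
      have h1 := (le_div_iff₀ (by linarith : 0 < Real.logb 2 n)).1 hs
      have h2 : (rN n : ℝ) * MN n ≤ 2 * Real.logb 2 n * MN n :=
        mul_le_mul_of_nonneg_right hl3 (by positivity)
      have h3 : (FinDigraph.space _ t P : ℝ) * 16 * Real.logb 2 n ≤ MN n * Real.logb 2 n := by
        nlinarith
      have h4 := le_of_mul_le_mul_right h3 (by linarith)
      exact_mod_cast h4
    obtain ⟨A, e, hA, he, hAe⟩ := lower_nat h rfl (posN n) t P hp hS hr hMr
    exact main_time hn2 hA he hAe
end
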